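/- arXiv:1607.00347 — 3 statements merged into one kernel-verified Lean document; each statement's English description precedes it below -/
import Mathlib

section
/- Let C = {C_0, ..., C_d} be a centered colorful configuration in R^d in relative general position with |C_i| ≥ 2 for all i. Then the number of hitting simplices (colorful transversals S of size d+1 with 0 ∈ conv(S)) is at most 1 + ∏_{i=0}^{d} (|C_i| - 1). -/
namespace CSD
open Finset

variable {V : Type*} [DecidableEq V]

/-- mod 2 coboundary -/
def dl (f : Finset V → ZMod 2) (σ : Finset V) : ZMod 2 := ∑ v ∈ σ, f (σ.erase v)

lemma dl_add (f g : Finset V → ZMod 2) (σ : Finset V) :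
    dl (fun τ => f τ + g τ) σ = dl f σ + dl g σ := by
  simp [dl, Finset.sum_add_distrib]

lemma dl_congr {f g : Finset V → ZMod 2} {σ : Finset V}
    (h : ∀ v ∈ σ, f (σ.erase v) = g (σ.erase v)) : dl f σ = dl g σ :=
  Finset.sum_congr rfl h

lemma z2 (a : ZMod 2) : a + a = 0 := CharTwo.add_self_eq_zero a

lemma dl_dl (f : Finset V → ZMod 2) (σ : Finset V) : dl (dl f) σ = 0 := by
  unfold dl
  rw [Finset.sum_sigma']
  refine Finset.sum_involution (fun p _ => ⟨p.2, p.1⟩) ?_ ?_ ?_ ?_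
  · rintro ⟨a, b⟩ h
    simp only [Finset.erase_right_comm (a := a) (b := b)]
    exact z2 _
  · rintro ⟨a, b⟩ h _ h2
    simp at h h2
    exact h.2.1 h2.1
  · rintro ⟨a, b⟩ h
    simp at h ⊢
    exact ⟨h.2.2, fun e => h.2.1 e.symm, h.1⟩
  · rintro ⟨a, b⟩ h
    rfl

def Coc (A : Finset V → Prop) (n : ℕ) (f : Finset V → ZMod 2) : Prop :=
  ∀ σ, A σ → σ.card = n + 1 → dl f σ = 0

def Cob (A : Finset V → Prop) (n : ℕ) (f : Finset V → ZMod 2) : Prop :=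
  ∃ g, ∀ σ, A σ → σ.card = n → f σ = dl g σ

def Acyc (A : Finset V → Prop) (n : ℕ) : Prop := ∀ f, Coc A n f → Cob A n f

def AtMostOne (A : Finset V → Prop) (n : ℕ) : Prop :=
  ∀ f₁ f₂, Coc A n f₁ → Coc A n f₂ →
    Cob A n f₁ ∨ Cob A n f₂ ∨ Cob A n (fun σ => f₁ σ + f₂ σ)

def Down (A : Finset V → Prop) : Prop := ∀ σ v, A σ → A (σ.erase v)

lemma glue {A B C : Finset V → Prop} (hB : Down B) (hC : Down C)
    (hA : ∀ σ, A σ → B σ ∨ C σ) {n : ℕ} {f g₁ g₂ : Finset V → ZMod 2}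
    (h1 : ∀ σ, B σ → σ.card = n + 1 → f σ = dl g₁ σ)
    (h2 : ∀ σ, C σ → σ.card = n + 1 → f σ = dl g₂ σ)
    (h : Cob (fun σ => B σ ∧ C σ) n (fun σ => g₁ σ + g₂ σ)) : Cob A (n + 1) f := by
  classical
  obtain ⟨w, hw⟩ := h
  refine ⟨fun σ => if B σ then g₁ σ else g₂ σ + dl w σ, fun σ hσ hn => ?_⟩
  have hcard : ∀ v ∈ σ, (σ.erase v).card = n := fun v hv => by
    rw [Finset.card_erase_of_mem hv, hn]; rfl
  by_cases hb : B σ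
  · rw [h1 σ hb hn]
    refine dl_congr fun v hv => ?_
    simp [hB σ v hb]
  · have hc := (hA σ hσ).resolve_left hb
    have : dl (fun σ => if B σ then g₁ σ else g₂ σ + dl w σ) σ
        = dl (fun σ => g₂ σ + dl w σ) σ := by
      refine dl_congr fun v hv => ?_
      by_cases hb' : B (σ.erase v)
      · have := hw _ ⟨hb', hC σ v hc⟩ (hcard v hv)
        simp only [hb', if_true]
        rw [← this]
        rw [add_comm, add_assoc, z2, add_zero]
      · simp [hb']
    rw [this, dl_add, dl_dl, add_zero, h2 σ hc hn]

lemma coc_diff {B C : Finset V → Prop} {n : ℕ} {f g₁ g₂ : Finset V → ZMod 2}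
    (h1 : ∀ σ, B σ → σ.card = n + 1 → f σ = dl g₁ σ)
    (h2 : ∀ σ, C σ → σ.card = n + 1 → f σ = dl g₂ σ) :
    Coc (fun σ => B σ ∧ C σ) n (fun σ => g₁ σ + g₂ σ) := by
  intro σ hσ hn
  rw [dl_add, ← h1 σ hσ.1 hn, ← h2 σ hσ.2 hn, z2]

lemma Coc.mono {A B : Finset V → Prop} {n : ℕ} {f : Finset V → ZMod 2} (h : Coc A n f)
    (hBA : ∀ σ, B σ → A σ) : Coc B n f := fun σ hσ hn => h σ (hBA σ hσ) hn

lemma Coc.add {A : Finset V → Prop} {n : ℕ} {f g : Finset V → ZMod 2} (h : Coc A n f)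
    (h' : Coc A n g) : Coc A n (fun σ => f σ + g σ) := fun σ hσ hn => by
  rw [dl_add, h σ hσ hn, h' σ hσ hn, add_zero]

lemma mv_acyc {A B C D : Finset V → Prop} (hB : Down B) (hC : Down C)
    (hA : ∀ σ, A σ ↔ B σ ∨ C σ) (hD : ∀ σ, D σ ↔ B σ ∧ C σ) {n : ℕ}
    (aB : Acyc B (n + 1)) (aC : Acyc C (n + 1)) (aD : Acyc D n) : Acyc A (n + 1) := by
  obtain rfl : D = fun σ => B σ ∧ C σ := funext fun σ => propext (hD σ)
  intro f hf
  obtain ⟨g₁, h1⟩ := aB f (hf.mono fun σ h => (hA σ).2 (Or.inl h))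
  obtain ⟨g₂, h2⟩ := aC f (hf.mono fun σ h => (hA σ).2 (Or.inr h))
  exact glue hB hC (fun σ => (hA σ).1) h1 h2 (aD _ (coc_diff h1 h2))

lemma mv_one {A B C D : Finset V → Prop} (hB : Down B) (hC : Down C)
    (hA : ∀ σ, A σ ↔ B σ ∨ C σ) (hD : ∀ σ, D σ ↔ B σ ∧ C σ) {n : ℕ}
    (aB : Acyc B (n + 1)) (aC : Acyc C (n + 1)) (aD : AtMostOne D n) :
    AtMostOne A (n + 1) := by
  obtain rfl : D = fun σ => B σ ∧ C σ := funext fun σ => propext (hD σ)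
  intro f f' hf hf'
  obtain ⟨g₁, h1⟩ := aB f (hf.mono fun σ h => (hA σ).2 (Or.inl h))
  obtain ⟨g₂, h2⟩ := aC f (hf.mono fun σ h => (hA σ).2 (Or.inr h))
  obtain ⟨g₁', h1'⟩ := aB f' (hf'.mono fun σ h => (hA σ).2 (Or.inl h))
  obtain ⟨g₂', h2'⟩ := aC f' (hf'.mono fun σ h => (hA σ).2 (Or.inr h))
  rcases aD _ _ (coc_diff h1 h2) (coc_diff h1' h2') with h | h | h
  · exact Or.inl (glue hB hC (fun σ => (hA σ).1) h1 h2 h)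
  · exact Or.inr (Or.inl (glue hB hC (fun σ => (hA σ).1) h1' h2' h))
  · refine Or.inr (Or.inr (glue hB hC (fun σ => (hA σ).1)
      (g₁ := fun σ => g₁ σ + g₁' σ) (g₂ := fun σ => g₂ σ + g₂' σ) ?_ ?_ ?_))
    · intro σ hσ hn
      rw [dl_add, h1 σ hσ hn, h1' σ hσ hn]
    · intro σ hσ hn
      rw [dl_add, h2 σ hσ hn, h2' σ hσ hn]
    · convert h using 2
      ring

lemma cone_acyc {A : Finset V → Prop} (x : V) (hx : ∀ σ, A σ → A (insert x σ)) (n : ℕ) :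
    Acyc A n := by
  intro f hf
  refine ⟨fun σ => if x ∈ σ then 0 else f (insert x σ), fun σ hσ hn => ?_⟩
  by_cases h : x ∈ σ
  · unfold dl
    rw [Finset.sum_eq_single_of_mem x h]
    · simp [Finset.insert_erase h]
    · intro b hb hbx
      simp [h, Ne.symm hbx]
  · have := hf _ (hx σ hσ) (by rw [Finset.card_insert_of_notMem h, hn])
    unfold dl at this ⊢
    rw [Finset.sum_insert h, Finset.erase_insert h] at this
    have e : f σ = ∑ v ∈ σ, f ((insert x σ).erase v) := by
      rw [← sub_eq_zero, CharTwo.sub_eq_add]; exact this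
    rw [e]
    refine Finset.sum_congr rfl fun v hv => ?_
    have hvx : v ≠ x := fun e => h (e ▸ hv)
    simp only [Finset.mem_erase, h, and_false, if_false]
    rw [Finset.erase_insert_of_ne hvx.symm]

variable {K : Type*} [DecidableEq K]

/-- at most one vertex of each colour -/
def Col (c : V → K) (σ : Finset V) : Prop := ∀ u ∈ σ, ∀ v ∈ σ, c u = c v → u = v

lemma join_acyc (c : V → K) : ∀ (m : ℕ) (P : Finset V) (n : ℕ), P.card ≤ m →
    n + 1 ≤ (P.image c).card → Acyc (fun σ => Col c σ ∧ σ ⊆ P) n := by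
  intro m
  induction m with
  | zero =>
    intro P n h1 h2
    have : P = ∅ := by simpa using h1
    subst this
    simp at h2
  | succ m ih =>
    intro P n h1 h2
    cases n with
    | zero =>
      intro f hf
      have : P.Nonempty := by
        rw [Finset.nonempty_iff_ne_empty]; rintro rfl; simp at h2
      obtain ⟨v, hv⟩ := this
      have := hf {v} ⟨by intro a ha b hb _; simp at ha hb; rw [ha, hb], by simpa using hv⟩ (by simp)
      refine ⟨0, fun σ _ hn => ?_⟩
      have : σ = ∅ := by simpa using hn
      subst this
      simpa [dl] using this
    | succ n =>
      by_cases hinj : ∃ x ∈ P, ∃ b ∈ P, x ≠ b ∧ c x = c b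
      · obtain ⟨x, hx, b, hb, hxb, hc⟩ := hinj
        have hPx : (P.erase x).card ≤ m := by
          rw [Finset.card_erase_of_mem hx]; omega
        refine mv_acyc (B := fun σ => Col c σ ∧ σ ⊆ P.erase x)
          (C := fun σ => Col c (insert x σ) ∧ σ ⊆ P)
          (D := fun σ => Col c σ ∧ σ ⊆ P.filter (fun v => c v ≠ c x)) ?_ ?_ ?_ ?_ ?_ ?_ ?_
        · rintro σ v ⟨h, h'⟩
          exact ⟨fun a ha b hb => h a (Finset.mem_of_mem_erase ha) b (Finset.mem_of_mem_erase hb),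
            (Finset.erase_subset _ _).trans h'⟩
        · rintro σ v ⟨h, h'⟩
          have hs := Finset.insert_subset_insert x (Finset.erase_subset v σ)
          exact ⟨fun a ha b hb => h a (hs ha) b (hs hb), (Finset.erase_subset _ _).trans h'⟩
        · intro σ
          constructor
          · rintro ⟨h, h'⟩
            by_cases hxs : x ∈ σ
            · right; simp only [Finset.insert_eq_of_mem hxs]; exact ⟨h, h'⟩
            · left; exact ⟨h, Finset.subset_erase.2 ⟨h', hxs⟩⟩
          · rintro (⟨h, h'⟩ | ⟨h, h'⟩)
            · exact ⟨h, h'.trans (Finset.erase_subset _ _)⟩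
            · exact ⟨fun a ha b hb => h a (Finset.mem_insert_of_mem ha) b
                (Finset.mem_insert_of_mem hb), h'⟩
        · intro σ
          constructor
          · rintro ⟨h, h'⟩
            have hne : ∀ a ∈ σ, c a ≠ c x := fun a ha => (Finset.mem_filter.1 (h' ha)).2
            have hP : σ ⊆ P := h'.trans (Finset.filter_subset _ _)
            refine ⟨⟨h, Finset.subset_erase.2 ⟨hP, fun hh => hne x hh rfl⟩⟩, ?_, hP⟩
            intro a ha b hb hab
            rw [Finset.mem_insert] at ha hb
            rcases ha with rfl | ha <;> rcases hb with rfl | hb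
            · rfl
            · exact absurd hab.symm (hne b hb)
            · exact absurd hab (hne a ha)
            · exact h a ha b hb hab
          · rintro ⟨⟨h, h'⟩, h2, h3⟩
            refine ⟨h, fun a ha => Finset.mem_filter.2 ⟨h3 ha, fun e => ?_⟩⟩
            have := h2 a (Finset.mem_insert_of_mem ha) x (Finset.mem_insert_self _ _) e
            subst this
            simpa using h' ha
        · refine ih _ _ hPx ?_
          convert h2 using 2
          ext k
          simp only [Finset.mem_image, Finset.mem_erase]
          constructor
          · rintro ⟨a, ⟨_, ha⟩, rfl⟩; exact ⟨a, ha, rfl⟩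
          · rintro ⟨a, ha, rfl⟩
            by_cases e : a = x
            · subst e; exact ⟨b, ⟨hxb.symm, hb⟩, hc.symm⟩
            · exact ⟨a, ⟨e, ha⟩, rfl⟩
        · refine cone_acyc x ?_ _
          rintro σ ⟨h, h'⟩
          refine ⟨by simpa using h, Finset.insert_subset hx h'⟩
        · refine ih _ _ ?_ ?_
          · refine le_trans (Finset.card_le_card ?_) hPx
            intro v hv
            rw [Finset.mem_filter] at hv
            exact Finset.mem_erase.2 ⟨fun e => hv.2 (by rw [e]), hv.1⟩
          · have : (P.filter (fun v => c v ≠ c x)).image c = (P.image c).erase (c x) := by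
              ext k
              simp only [Finset.mem_image, Finset.mem_erase, Finset.mem_filter]
              constructor
              · rintro ⟨a, ⟨ha, h⟩, rfl⟩; exact ⟨h, a, ha, rfl⟩
              · rintro ⟨h, a, ha, rfl⟩; exact ⟨a, ⟨ha, h⟩, rfl⟩
            rw [this, Finset.card_erase_of_mem (Finset.mem_image_of_mem _ hx)]
            omega
      · push Not at hinj
        have : P.Nonempty := by
          rw [Finset.nonempty_iff_ne_empty]; rintro rfl; simp at h2
        obtain ⟨x, hx⟩ := this
        refine cone_acyc x ?_ _
        rintro σ ⟨h, h'⟩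
        have hs : insert x σ ⊆ P := Finset.insert_subset hx h'
        refine ⟨fun a ha b hb hab => ?_, hs⟩
        by_contra e
        exact hinj a (hs ha) b (hs hb) e hab

end CSD

namespace CSD
open Finset

set_option linter.unusedSectionVars false
section geom
variable {E : Type*} [NormedAddCommGroup E] [InnerProductSpace ℝ E] [FiniteDimensional ℝ E]

lemma seg_lt {p q : E} (h : inner ℝ p q < ‖p‖ ^ 2) :
    ∃ z ∈ segment ℝ p q, ‖z‖ < ‖p‖ := by
  by_contra! hc
  have key : ∀ t : ℝ, 0 < t → t ≤ 1 → 0 ≤ 2 * (inner ℝ p q - ‖p‖ ^ 2) + t * ‖q - p‖ ^ 2 := by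
    intro t ht ht1
    have h1 := hc (p + t • (q - p)) (by
      rw [segment_eq_image']; exact ⟨t, ⟨ht.le, ht1⟩, rfl⟩)
    have h2 : ‖p‖ ^ 2 ≤ ‖p + t • (q - p)‖ ^ 2 := by gcongr
    rw [norm_add_sq_real, inner_smul_right, inner_sub_right, real_inner_self_eq_norm_sq,
      norm_smul, mul_pow, Real.norm_eq_abs, sq_abs] at h2
    have h3 : 0 ≤ t * (2 * (inner ℝ p q - ‖p‖ ^ 2) + t * ‖q - p‖ ^ 2) := by nlinarith
    exact nonneg_of_mul_nonneg_right h3 ht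
  set a := ‖p‖ ^ 2 - inner ℝ p q with ha
  have hapos : 0 < a := by linarith
  set b := ‖q - p‖ ^ 2 with hb
  have hb0 : 0 ≤ b := by positivity
  have := key (min 1 (a / (b + 1))) (by positivity) (min_le_left _ _)
  have h4 : min 1 (a / (b + 1)) * b ≤ a / (b + 1) * b := by
    gcongr; exact min_le_right _ _
  have h5 : a / (b + 1) * b ≤ a := by
    rw [div_mul_eq_mul_div, div_le_iff₀ (by positivity)]; nlinarith
  linarith

lemma exists_le_of_mem_hull {S : Set E} {p z : E} {a : ℝ} (hz : z ∈ convexHull ℝ S)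
    (h : inner ℝ p z ≤ a) : ∃ x ∈ S, inner ℝ p x ≤ a := by
  by_contra! hc
  have hconv : Convex ℝ {x : E | a < inner ℝ p x} :=
    convex_halfSpace_gt (innerSL ℝ p).toLinearMap.isLinear a
  have := convexHull_min (s := S) (fun x hx => hc x hx) hconv hz
  exact absurd h (not_le.2 this)

lemma colorful_caratheodory {ι : Type*} [DecidableEq ι] [Fintype ι] (C : ι → Finset E)
    (h0 : ∀ i, (0 : E) ∈ convexHull ℝ (C i : Set E)) (M : Submodule ℝ E) (I : Finset ι)
    (hM : ∀ i ∈ I, ∀ x ∈ C i, x ∈ M) (hI : Module.finrank ℝ M < I.card) :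
    ∃ s : ι → E, (∀ i, s i ∈ C i) ∧ (0 : E) ∈ convexHull ℝ (s '' (I : Set ι)) := by
  classical
  have hne : ∀ i, (C i).Nonempty := fun i => by
    have : (convexHull ℝ (C i : Set E)).Nonempty := ⟨0, h0 i⟩
    simpa using this
  obtain ⟨s, hs, hmin⟩ := Finset.exists_min_image (Fintype.piFinset C)
    (fun s => Metric.infDist 0 (convexHull ℝ (s '' (I : Set ι))))
    (Fintype.piFinset_nonempty.2 hne)
  rw [Fintype.mem_piFinset] at hs
  refine ⟨s, hs, ?_⟩
  have hIne : I.Nonempty := Finset.card_pos.1 (by omega)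
  have hcpt : IsCompact (convexHull ℝ (s '' (I : Set ι))) :=
    Set.Finite.isCompact_convexHull (𝕜 := ℝ) (I.finite_toSet.image s)
  obtain ⟨p, hp, hpd⟩ := hcpt.exists_infDist_eq_dist (x := (0 : E)) (by
    rw [convexHull_nonempty_iff]; exact (Finset.coe_nonempty.2 hIne).image s)
  rw [dist_zero_left] at hpd
  by_contra hcon
  have hp0 : p ≠ 0 := fun e => hcon (e ▸ hp)
  have hpp : 0 < ‖p‖ ^ 2 := by positivity
  -- any transversal has all points at norm at least that of p
  have hge : ∀ s' : ι → E, (∀ i, s' i ∈ C i) → ∀ z ∈ convexHull ℝ (s' '' (I : Set ι)),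
      ‖p‖ ≤ ‖z‖ := by
    intro s' hs' z hz
    have h1 := hmin s' (Fintype.mem_piFinset.2 hs')
    have h2 := Metric.infDist_le_dist_of_mem (x := (0 : E)) hz
    rw [dist_zero_left] at h2
    linarith
  have hhalf : ∀ q ∈ convexHull ℝ (s '' (I : Set ι)), ‖p‖ ^ 2 ≤ inner ℝ p q := by
    intro q hq
    by_contra! hlt
    obtain ⟨z, hz, hlt⟩ := seg_lt hlt
    exact absurd (hge s hs z ((convex_convexHull ℝ _).segment_subset hp hq hz)) (not_le.2 hlt)
  obtain ⟨κ, _, z, w, hz, hai, hw, hw1, hwp⟩ := eq_pos_convex_span_of_mem_convexHull hp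
  have hzk : ∀ k, inner ℝ p (z k) = ‖p‖ ^ 2 := by
    have h1 : ∑ k, w k * (inner ℝ p (z k) - ‖p‖ ^ 2) = 0 := by
      simp only [mul_sub, Finset.sum_sub_distrib, ← Finset.sum_mul, hw1, one_mul]
      rw [sub_eq_zero, ← real_inner_self_eq_norm_sq]
      conv_rhs => rw [← hwp, inner_sum]
      rw [hwp]
      simp [inner_smul_right]
    have h2 := (Finset.sum_eq_zero_iff_of_nonneg (fun k _ => mul_nonneg (hw k).le
      (sub_nonneg.2 (hhalf (z k) (subset_convexHull ℝ _ (hz ⟨k, rfl⟩)))))).1 h1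
    intro k
    have := (mul_eq_zero.1 (h2 k (Finset.mem_univ k))).resolve_left (hw k).ne'
    linarith
  have hli : LinearIndependent ℝ z := by
    rw [Fintype.linearIndependent_iff]
    intro g hg k
    refine (affineIndependent_iff.1 hai) Finset.univ g ?_ hg k (Finset.mem_univ k)
    have := congrArg (fun v => inner ℝ p v) hg
    simp only [inner_sum, inner_smul_right, hzk, inner_zero_right, ← Finset.sum_mul] at this
    exact (mul_eq_zero.1 this).resolve_right hpp.ne'
  have hcard : Fintype.card κ ≤ Module.finrank ℝ M := by
    rw [← finrank_span_eq_card hli]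
    refine Submodule.finrank_mono (Submodule.span_le.2 ?_)
    rintro _ ⟨k, rfl⟩
    obtain ⟨i, hi, e⟩ := hz ⟨k, rfl⟩
    rw [← e]
    exact hM i hi _ (hs i)
  choose idx hidx hidxe using fun k => hz ⟨k, rfl⟩
  obtain ⟨j, hj, hjn⟩ : ∃ j ∈ I, j ∉ Finset.univ.image idx := by
    by_contra! hc
    have := Finset.card_le_card (s := I) (t := Finset.univ.image idx) hc
    have h2 := Finset.card_image_le (s := (Finset.univ : Finset κ)) (f := idx)
    rw [Finset.card_univ] at h2
    omega
  obtain ⟨x, hx, hxle⟩ := exists_le_of_mem_hull (p := p) (a := 0) (h0 j) (by simp)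
  obtain ⟨y, hy, hlt⟩ := seg_lt (p := p) (q := x) (by linarith)
  refine absurd (hge (Function.update s j x) ?_ y ?_) (not_le.2 hlt)
  · intro i
    by_cases e : i = j
    · subst e; simpa using hx
    · simpa [e] using hs i
  · refine (convex_convexHull ℝ _).segment_subset ?_ ?_ hy
    · rw [← hwp]
      refine (convex_convexHull ℝ _).sum_mem (fun k _ => (hw k).le) hw1 fun k _ => ?_
      refine subset_convexHull ℝ _ ⟨idx k, hidx k, ?_⟩
      have : idx k ≠ j := fun e => hjn (e ▸ Finset.mem_image_of_mem _ (Finset.mem_univ k))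
      simp [this, hidxe]
    · exact subset_convexHull ℝ _ ⟨j, hj, by simp⟩

lemma centered_pos {S : Set E} (h : (0 : E) ∈ intrinsicInterior ℝ (convexHull ℝ S)) {w x : E}
    (hx : x ∈ S) (hwx : inner ℝ w x ≠ 0) : ∃ y ∈ S, 0 < inner ℝ w y := by
  by_contra! hc
  have hneg : inner ℝ w x < 0 := lt_of_le_of_ne (hc x hx) hwx
  have hle : ∀ z ∈ convexHull ℝ S, inner ℝ w z ≤ 0 := by
    have hconv : Convex ℝ {x : E | inner ℝ w x ≤ 0} :=
      convex_halfSpace_le (innerSL ℝ w).toLinearMap.isLinear 0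
    exact fun z hz => convexHull_min (s := S) (fun x hx => hc x hx) hconv hz
  rw [mem_intrinsicInterior] at h
  obtain ⟨y, hy, hy0⟩ := h
  have hx' : x ∈ affineSpan ℝ (convexHull ℝ S) :=
    subset_affineSpan ℝ _ (subset_convexHull ℝ _ hx)
  have h0' : (0 : E) ∈ affineSpan ℝ (convexHull ℝ S) := hy0 ▸ y.2
  let g : ℝ → affineSpan ℝ (convexHull ℝ S) := fun t =>
    ⟨AffineMap.lineMap 0 x t, AffineMap.lineMap_mem t h0' hx'⟩
  have hg : Continuous g := by
    refine Continuous.subtype_mk ?_ _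
    exact AffineMap.lineMap_continuous
  have hg0 : g 0 = y := by
    apply Subtype.ext; simp [g, hy0]
  have hev : ∀ᶠ t in nhds (0 : ℝ), g t ∈ interior ((↑) ⁻¹' (convexHull ℝ S) : Set (affineSpan ℝ (convexHull ℝ S))) := by
    refine hg.continuousAt.eventually (isOpen_interior.mem_nhds ?_)
    rw [hg0]; exact hy
  obtain ⟨ε, hε, hball⟩ := Metric.eventually_nhds_iff.1 hev
  have := interior_subset (hball (y := -(ε / 2)) (by
    rw [Real.dist_eq]; rw [sub_zero, abs_neg, abs_of_pos (by positivity)]; linarith))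
  have h3 := hle _ this
  simp [g, AffineMap.lineMap_apply, inner_smul_right] at h3
  nlinarith

lemma finrank_cut (L : Submodule ℝ E) {x v : E} (hv : v ∈ L) (hvx : inner ℝ v x ≠ 0) :
    Module.finrank ℝ L = Module.finrank ℝ (L ⊓ (ℝ ∙ x)ᗮ : Submodule ℝ E) + 1 := by
  let φ : L →ₗ[ℝ] ℝ := (innerSL ℝ x).toLinearMap.domRestrict L
  have h1 := φ.finrank_range_add_finrank_ker
  have h2 : LinearMap.range φ = ⊤ := by
    rw [LinearMap.range_eq_top]
    refine LinearMap.surjective_of_ne_zero ?_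
    intro e
    apply hvx
    have := congrArg (fun f => f ⟨v, hv⟩) e
    rw [real_inner_comm]
    simpa [φ] using this
  have h3 : (LinearMap.ker φ).map L.subtype = L ⊓ (ℝ ∙ x)ᗮ := by
    ext z
    simp only [Submodule.mem_map, LinearMap.mem_ker, Submodule.mem_inf,
      Submodule.mem_orthogonal_singleton_iff_inner_right]
    constructor
    · rintro ⟨y, hy, rfl⟩; exact ⟨y.2, by simpa [φ] using hy⟩
    · rintro ⟨h, h'⟩; exact ⟨⟨z, h⟩, by simpa [φ] using h', rfl⟩
  rw [h2, finrank_top, Module.finrank_self] at h1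
  rw [← h3, ← (Submodule.equivMapOfInjective L.subtype L.injective_subtype
    (LinearMap.ker φ)).finrank_eq]
  omega
end geom
end CSD
namespace CSD
open Finset
set_option linter.unusedSectionVars false
section main
variable {E : Type*} [NormedAddCommGroup E] [InnerProductSpace ℝ E] [FiniteDimensional ℝ E]
variable {K : Type*} [DecidableEq K] [DecidableEq E]

/-- simplices positive on some functional in `L ∩ O` -/
def Av (P : Finset (K × E)) (L : Submodule ℝ E) (O : Set E) (σ : Finset (K × E)) : Prop :=
  (Col Prod.fst σ ∧ σ ⊆ P) ∧ ∃ w ∈ L, w ∈ O ∧ ∀ p ∈ σ, 0 < inner ℝ w p.2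

lemma down_av (P : Finset (K × E)) (L : Submodule ℝ E) (O : Set E) : Down (Av P L O) := by
  rintro σ v ⟨⟨h1, h2⟩, w, hw, hO, h⟩
  exact ⟨⟨fun a ha b hb => h1 a (Finset.mem_of_mem_erase ha) b (Finset.mem_of_mem_erase hb),
    (Finset.erase_subset _ _).trans h2⟩, w, hw, hO, fun p hp => h p (Finset.mem_of_mem_erase hp)⟩

lemma isOpen_pos (σ : Finset (K × E)) : IsOpen {w : E | ∀ p ∈ σ, 0 < inner ℝ w p.2} := by
  have : {w : E | ∀ p ∈ σ, 0 < inner ℝ w p.2} = ⋂ p ∈ σ, {w : E | 0 < inner ℝ w p.2} := by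
    ext; simp
  rw [this]
  exact isOpen_biInter_finset fun p _ => isOpen_lt continuous_const (by fun_prop)

/-- perturbation -/
lemma perturb {O : Set E} (hO : IsOpen O) {w : E} (hw : w ∈ O) (v : E) :
    ∃ t : ℝ, 0 < t ∧ w + t • v ∈ O := by
  have hc : Continuous fun t : ℝ => w + t • v := by fun_prop
  have : ∀ᶠ t in nhds (0 : ℝ), w + t • v ∈ O :=
    hc.continuousAt.eventually (hO.mem_nhds (by simpa using hw))
  obtain ⟨ε, hε, h⟩ := Metric.eventually_nhds_iff.1 this
  exact ⟨ε / 2, by positivity, h (by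
    rw [Real.dist_eq, sub_zero, abs_of_pos (by positivity)]; linarith)⟩

lemma exists_sign {L : Submodule ℝ E} {x v : E} (hv : v ∈ L) (hvx : inner ℝ v x ≠ 0) :
    ∃ u ∈ L, 0 < inner ℝ u x := by
  rcases lt_or_gt_of_ne hvx with h | h
  · exact ⟨-v, L.neg_mem hv, by rw [inner_neg_left]; linarith⟩
  · exact ⟨v, hv, h⟩

lemma av_union (P : Finset (K × E)) {L : Submodule ℝ E} {O : Set E} (hO : IsOpen O)
    {x v : E} (hv : v ∈ L) (hvx : inner ℝ v x ≠ 0) (σ : Finset (K × E)) :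
    Av P L O σ ↔ Av P L (O ∩ {w | 0 < inner ℝ w x}) σ ∨ Av P L (O ∩ {w | inner ℝ w x < 0}) σ := by
  constructor
  · rintro ⟨h, w, hwL, hwO, hw⟩
    rcases lt_trichotomy (inner ℝ w x) 0 with hx | hx | hx
    · exact Or.inr ⟨h, w, hwL, ⟨hwO, hx⟩, hw⟩
    · left
      obtain ⟨u, hu, hux⟩ := exists_sign hv hvx
      obtain ⟨t, ht, h1, h2⟩ := perturb (hO.inter (isOpen_pos σ)) ⟨hwO, hw⟩ u
      refine ⟨h, w + t • u, L.add_mem hwL (L.smul_mem t hu), ⟨h1, ?_⟩, h2⟩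
      show 0 < inner ℝ (w + t • u) x
      rw [inner_add_left, hx, inner_smul_left]
      simp; positivity
    · exact Or.inl ⟨h, w, hwL, ⟨hwO, hx⟩, hw⟩
  · rintro (⟨h, w, hwL, hwO, hw⟩ | ⟨h, w, hwL, hwO, hw⟩) <;> exact ⟨h, w, hwL, hwO.1, hw⟩

lemma av_inter (P : Finset (K × E)) {L : Submodule ℝ E} {O : Set E} (hO : IsOpen O)
    (hconv : Convex ℝ O)
    {x v : E} (hv : v ∈ L) (hvx : inner ℝ v x ≠ 0) (σ : Finset (K × E)) :
    Av P (L ⊓ (ℝ ∙ x)ᗮ) O σ ↔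
      Av P L (O ∩ {w | 0 < inner ℝ w x}) σ ∧ Av P L (O ∩ {w | inner ℝ w x < 0}) σ := by
  constructor
  · rintro ⟨h, w, ⟨hwL, hwx⟩, hwO, hw⟩
    rw [SetLike.mem_coe, Submodule.mem_orthogonal_singleton_iff_inner_left] at hwx
    obtain ⟨u, hu, hux⟩ := exists_sign hv hvx
    obtain ⟨t, ht, h1, h2⟩ := perturb (hO.inter (isOpen_pos σ)) ⟨hwO, hw⟩ u
    obtain ⟨t', ht', h1', h2'⟩ := perturb (hO.inter (isOpen_pos σ)) ⟨hwO, hw⟩ (-u)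
    refine ⟨⟨h, w + t • u, L.add_mem hwL (L.smul_mem t hu), ⟨h1, ?_⟩, h2⟩,
      ⟨h, w + t' • (-u), L.add_mem hwL (L.smul_mem t' (L.neg_mem hu)), ⟨h1', ?_⟩, h2'⟩⟩
    · show 0 < inner ℝ (w + t • u) x
      rw [inner_add_left, hwx, inner_smul_left]
      simp; positivity
    · show inner ℝ (w + t' • (-u)) x < 0
      rw [inner_add_left, hwx, inner_smul_left, inner_neg_left]
      simp; positivity
  · rintro ⟨⟨h, w, hwL, ⟨hwO, hwx⟩, hw⟩, ⟨_, w', hwL', ⟨hwO', hwx'⟩, hw'⟩⟩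
    simp only [Set.mem_ofPred_eq] at hwx hwx'
    set a := inner ℝ w x with ha
    set b := -inner ℝ w' x with hb
    have hb0 : 0 < b := by linarith
    have hab : b / (a + b) + a / (a + b) = 1 := by field_simp; ring
    refine ⟨h, (b / (a + b)) • w + (a / (a + b)) • w', ⟨L.add_mem (L.smul_mem _ hwL)
      (L.smul_mem _ hwL'), ?_⟩, hconv hwO hwO' (by positivity) (by positivity) hab, ?_⟩
    · rw [SetLike.mem_coe, Submodule.mem_orthogonal_singleton_iff_inner_left]
      rw [inner_add_left, inner_smul_left, inner_smul_left, ← ha]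
      have : inner ℝ w' x = -b := by rw [hb]; ring
      rw [this]
      simp; ring
    · intro p hp
      rw [inner_add_left, inner_smul_left, inner_smul_left]
      have h1 := hw p hp
      have h2 := hw' p hp
      simp only [conj_trivial]
      positivity

variable (P : Finset (K × E))

/-- hypotheses: every functional nonzero on a colour is positive somewhere on it -/
def Cent : Prop := ∀ w : E, ∀ p ∈ P, inner ℝ w p.2 ≠ 0 → ∃ q ∈ P, q.1 = p.1 ∧ 0 < inner ℝ w q.2

open Classical in
/-- colours that are not degenerate on `L` -/
noncomputable def nd (L : Submodule ℝ E) : Finset K :=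
  (P.filter fun p => ∃ v ∈ L, inner ℝ v p.2 ≠ 0).image Prod.fst

open Classical in
noncomputable def cuts (L : Submodule ℝ E) (O : Set E) : Finset (K × E) :=
  P.filter fun p => (∃ v ∈ L, inner ℝ v p.2 ≠ 0) ∧ ∃ w ∈ L, w ∈ O ∧ inner ℝ w p.2 = 0

lemma acyc_base (hc : Cent P) (L : Submodule ℝ E) (O : Set E) (hne : ∃ w ∈ L, w ∈ O)
    (hO : IsOpen O) (hconv : Convex ℝ O)
    (hcut : cuts P L O = ∅) (n : ℕ) (hn : n + 1 ≤ (nd P L).card) : Acyc (Av P L O) n := by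
  classical
  obtain ⟨w, hwL, hwO⟩ := hne
  have hnz : ∀ p ∈ P, (∃ v ∈ L, inner ℝ v p.2 ≠ 0) → ∀ w ∈ L, w ∈ O → inner ℝ w p.2 ≠ 0 := by
    intro p hp hv w' hL' hO' e
    have : p ∈ cuts P L O := by
      unfold cuts; exact Finset.mem_filter.2 ⟨hp, hv, w', hL', hO', e⟩
    simp [hcut] at this
  have key : Av P L O = fun σ => Col Prod.fst σ ∧ σ ⊆ P.filter (fun p => 0 < inner ℝ w p.2) := by
    funext σ
    apply propext
    constructor
    · rintro ⟨⟨h1, h2⟩, w', hL', hO', h⟩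
      refine ⟨h1, fun p hp => Finset.mem_filter.2 ⟨h2 hp, ?_⟩⟩
      by_contra hle
      have hpos := h p hp
      have hv : ∃ v ∈ L, inner ℝ v p.2 ≠ 0 := ⟨w', hL', hpos.ne'⟩
      have hlt : inner ℝ w p.2 < 0 :=
        lt_of_le_of_ne (not_lt.1 hle) (hnz p (h2 hp) hv w hwL hwO)
      have hD : Av ({p} : Finset (K × E)) (L ⊓ (ℝ ∙ p.2)ᗮ) O ∅ := by
        rw [av_inter _ hO hconv hL' hpos.ne']
        have hcol : Col Prod.fst (∅ : Finset (K × E)) ∧ (∅ : Finset (K × E)) ⊆ {p} :=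
          ⟨fun a ha => by simp at ha, by simp⟩
        exact ⟨⟨hcol, w', hL', ⟨hO', hpos⟩, by simp⟩, ⟨hcol, w, hwL, ⟨hwO, hlt⟩, by simp⟩⟩
      obtain ⟨_, u, ⟨huL, hux⟩, huO, _⟩ := hD
      rw [SetLike.mem_coe, Submodule.mem_orthogonal_singleton_iff_inner_left] at hux
      exact hnz p (h2 hp) hv u huL huO hux
    · rintro ⟨h1, h2⟩
      exact ⟨⟨h1, h2.trans (Finset.filter_subset _ _)⟩, w, hwL, hwO,
        fun p hp => (Finset.mem_filter.1 (h2 hp)).2⟩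
  rw [key]
  refine join_acyc _ _ _ n le_rfl (hn.trans (Finset.card_le_card ?_))
  intro k hk
  unfold nd at hk
  obtain ⟨p, hp, rfl⟩ := Finset.mem_image.1 hk
  obtain ⟨hpP, hv⟩ := Finset.mem_filter.1 hp
  obtain ⟨q, hq, hqp, hpos⟩ := hc w p hpP (hnz p hpP hv w hwL hwO)
  exact Finset.mem_image.2 ⟨q, Finset.mem_filter.2 ⟨hq, hpos⟩, hqp⟩

lemma acyc_main (hc : Cent P)
    (hnd : ∀ L : Submodule ℝ E, 1 ≤ Module.finrank ℝ L → Module.finrank ℝ L + 1 ≤ (nd P L).card) :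
    ∀ (l m : ℕ) (L : Submodule ℝ E) (O : Set E), Module.finrank ℝ L = l →
      (cuts P L O).card ≤ m → IsOpen O → Convex ℝ O → (0 : E) ∉ O → (∃ w ∈ L, w ∈ O) →
      Acyc (Av P L O) l := by
  classical
  intro l
  induction l with
  | zero =>
    intro m L O hl _ _ _ h0 ⟨w, hwL, hwO⟩
    rw [Submodule.finrank_eq_zero] at hl
    subst hl
    rw [Submodule.mem_bot] at hwL
    exact absurd (hwL ▸ hwO) h0
  | succ l ihl =>
    intro m
    induction m with
    | zero =>
      intro L O hl hm hO hconv h0 hne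
      refine acyc_base P hc L O hne hO hconv (by simpa using hm) _ ?_
      rw [← hl]; exact hnd L (by omega)
    | succ m ihm =>
      intro L O hl hm hO hconv h0 hne
      by_cases hcut : cuts P L O = ∅
      · refine acyc_base P hc L O hne hO hconv hcut _ ?_
        rw [← hl]; exact hnd L (by omega)
      obtain ⟨p, hp⟩ := Finset.nonempty_iff_ne_empty.2 hcut
      have hp' := hp
      unfold cuts at hp'
      obtain ⟨hpP, ⟨v, hvL, hvp⟩, w, hwL, hwO, hwp⟩ := Finset.mem_filter.1 hp'
      have hD : Av P (L ⊓ (ℝ ∙ p.2)ᗮ) O ∅ :=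
        ⟨⟨fun a ha => by simp at ha, by simp⟩, w, ⟨hwL, by
          rw [SetLike.mem_coe, Submodule.mem_orthogonal_singleton_iff_inner_left]; exact hwp⟩,
          hwO, by simp⟩
      have hBC := (av_inter P hO hconv hvL hvp ∅).1 hD
      have hfr := finrank_cut L hvL hvp
      have hcard : ∀ O' : Set E, O' ⊆ O → (∀ w ∈ O', inner ℝ w p.2 ≠ 0) →
          (cuts P L O').card ≤ m := by
        intro O' hO' hnz
        have : cuts P L O' ⊆ (cuts P L O).erase p := by
          intro q hq
          unfold cuts at hq
          obtain ⟨hqP, hv, w, hwL, hwO, hwq⟩ := Finset.mem_filter.1 hq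
          refine Finset.mem_erase.2 ⟨?_, ?_⟩
          · rintro rfl; exact hnz w hwO hwq
          · unfold cuts
            exact Finset.mem_filter.2 ⟨hqP, hv, w, hwL, hO' hwO, hwq⟩
        have h2 := Finset.card_le_card this
        rw [Finset.card_erase_of_mem hp] at h2
        omega
      refine mv_acyc (down_av P L _) (down_av P L _) (av_union P hO hvL hvp)
        (av_inter P hO hconv hvL hvp) ?_ ?_ ?_
      · refine ihm L _ hl (hcard _ Set.inter_subset_left fun w hw => (ne_of_gt hw.2))
          (hO.inter (isOpen_lt continuous_const (by fun_prop)))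
          (hconv.inter ?_) (fun h => h0 h.1) ?_
        · have := convex_halfSpace_gt (innerSL ℝ p.2).toLinearMap.isLinear 0
          simpa [real_inner_comm] using this
        · obtain ⟨_, w, hw, hw2, _⟩ := hBC.1
          exact ⟨w, hw, hw2⟩
      · refine ihm L _ hl (hcard _ Set.inter_subset_left fun w hw => (ne_of_lt hw.2))
          (hO.inter (isOpen_lt (by fun_prop) continuous_const))
          (hconv.inter ?_) (fun h => h0 h.1) ?_
        · have := convex_halfSpace_lt (innerSL ℝ p.2).toLinearMap.isLinear 0
          simpa [real_inner_comm] using this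
        · obtain ⟨_, w, hw, hw2, _⟩ := hBC.2
          exact ⟨w, hw, hw2⟩
      · refine ihl _ (L ⊓ (ℝ ∙ p.2)ᗮ) O (by omega) le_rfl hO hconv h0 ?_
        obtain ⟨_, w, hw, hw2, _⟩ := hD
        exact ⟨w, hw, hw2⟩

lemma one_main (hc : Cent P)
    (hnd : ∀ L : Submodule ℝ E, 1 ≤ Module.finrank ℝ L → Module.finrank ℝ L + 1 ≤ (nd P L).card) :
    ∀ (l : ℕ) (L : Submodule ℝ E), Module.finrank ℝ L = l → AtMostOne (Av P L Set.univ) l := by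
  classical
  intro l
  induction l with
  | zero =>
    intro L _ f g _ _
    have aux : ∀ h : Finset (K × E) → ZMod 2, h ∅ = 0 → Cob (Av P L Set.univ) 0 h := by
      intro h hh
      refine ⟨0, fun σ _ hn => ?_⟩
      have : σ = ∅ := by simpa using hn
      subst this
      simpa [dl] using hh
    have : f ∅ = 0 ∨ g ∅ = 0 ∨ f ∅ + g ∅ = 0 := by
      generalize f ∅ = a; generalize g ∅ = b
      revert a b; decide
    rcases this with h | h | h
    · exact Or.inl (aux _ h)
    · exact Or.inr (Or.inl (aux _ h))
    · exact Or.inr (Or.inr (aux _ h))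
  | succ l ih =>
    intro L hl
    have h1 := hnd L (by omega)
    have h2 : (nd P L).Nonempty := Finset.card_pos.1 (by omega)
    unfold nd at h2
    obtain ⟨p, hp⟩ := Finset.image_nonempty.1 h2
    obtain ⟨hpP, v, hvL, hvp⟩ := Finset.mem_filter.1 hp
    have hO : IsOpen (Set.univ : Set E) := isOpen_univ
    have hconv : Convex ℝ (Set.univ : Set E) := convex_univ
    have hfr := finrank_cut L hvL hvp
    have hD : Av P (L ⊓ (ℝ ∙ p.2)ᗮ) Set.univ ∅ :=
        ⟨⟨fun a ha => by simp at ha, by simp⟩, 0, Submodule.zero_mem _, trivial, by simp⟩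
    have hBC := (av_inter P hO hconv hvL hvp ∅).1 hD
    refine mv_one (down_av P L _) (down_av P L _) (av_union P hO hvL hvp)
        (av_inter P hO hconv hvL hvp) ?_ ?_ (ih _ (by omega))
    · refine acyc_main P hc hnd _ _ L _ hl le_rfl
          (hO.inter (isOpen_lt continuous_const (by fun_prop)))
          (hconv.inter ?_) (fun h => by simpa using h.2) ?_
      · have := convex_halfSpace_gt (innerSL ℝ p.2).toLinearMap.isLinear 0
        simpa [real_inner_comm] using this
      · obtain ⟨_, w, hw, hw2, _⟩ := hBC.1
        exact ⟨w, hw, hw2⟩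
    · refine acyc_main P hc hnd _ _ L _ hl le_rfl
          (hO.inter (isOpen_lt (by fun_prop) continuous_const))
          (hconv.inter ?_) (fun h => by simpa using h.2) ?_
      · have := convex_halfSpace_lt (innerSL ℝ p.2).toLinearMap.isLinear 0
        simpa [real_inner_comm] using this
      · obtain ⟨_, w, hw, hw2, _⟩ := hBC.2
        exact ⟨w, hw, hw2⟩
end main
end CSD
namespace CSD
open Finset
section count
variable {E : Type*} [DecidableEq E] {k : ℕ}

/-- octahedral functional -/
def oct (b : Fin k → E) (F : (Fin k → E) → ZMod 2) (a : Fin k → E) : ZMod 2 :=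
  ∑ ε : Finset (Fin k), F (ε.piecewise b a)

lemma oct_eq_zero (b : Fin k → E) (F : (Fin k → E) → ZMod 2) (a : Fin k → E) (i : Fin k)
    (h : a i = b i) : oct b F a = 0 := by
  have key : ∀ ε : Finset (Fin k), (symmDiff ε {i}).piecewise b a = ε.piecewise b a := by
    intro ε
    funext j
    by_cases hj : j = i
    · subst hj
      simp only [Finset.piecewise, h, ite_self]
    · simp [Finset.piecewise, Finset.mem_symmDiff, hj]
  unfold oct
  refine Finset.sum_involution (fun ε _ => symmDiff ε {i}) ?_ ?_ ?_ ?_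
  · intro ε _
    rw [key]; exact z2 _
  · intro ε _ _ e
    have := congrArg (fun s => i ∈ s) e
    simp [Finset.mem_symmDiff] at this
  · intro ε _; simp
  · intro ε _; simp

/-- the full simplex of a transversal -/
def simp (a : Fin k → E) : Finset (Fin k × E) := Finset.univ.image fun i => (i, a i)

lemma mem_simp (a : Fin k → E) (p : Fin k × E) : p ∈ simp a ↔ p.2 = a p.1 := by
  unfold simp
  rw [Finset.mem_image]
  constructor
  · rintro ⟨i, _, rfl⟩; rfl
  · intro h; exact ⟨p.1, Finset.mem_univ _, by rw [← h]⟩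

lemma card_simp (a : Fin k → E) : (simp a).card = k := by
  unfold simp
  rw [Finset.card_image_of_injective _ (fun i j h => (Prod.ext_iff.1 h).1)]
  simp

lemma exists_cob (b : Fin k → E) (F : (Fin k → E) → ZMod 2) :
    ∃ g : Finset (Fin k × E) → ZMod 2, ∀ a, oct b F a = 0 → F a = dl g (simp a) := by
  classical
  by_cases hk : k = 0
  · subst hk
    refine ⟨0, fun a h => ?_⟩
    have : F a = 0 := by
      unfold oct at h
      rw [Fintype.sum_subsingleton _ (∅ : Finset (Fin 0))] at h
      simpa using h
    simp [dl, this]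
  have : NeZero k := ⟨hk⟩
  let m : Finset (Fin k) → Fin k := fun ε => if h : ε.Nonempty then h.choose else 0
  have hm : ∀ ε : Finset (Fin k), ε.Nonempty → m ε ∈ ε := fun ε h => by
    simp only [m, h, dif_pos]; exact h.choose_spec
  let st : Finset (Fin k × E) → Fin k → E := fun τ i =>
    if h : ∃ x, (i, x) ∈ τ then h.choose else b i
  let g : Finset (Fin k × E) → ZMod 2 := fun τ =>
    ∑ ε : Finset (Fin k) with (ε.Nonempty ∧ m ε ∉ τ.image Prod.fst), F (ε.piecewise b (st τ))
  refine ⟨g, fun a ha => ?_⟩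
  have h1 : dl g (simp a) = ∑ i, g ((simp a).erase (i, a i)) := by
    unfold dl
    conv_lhs => unfold simp
    rw [Finset.sum_image (fun i _ j _ h => (Prod.ext_iff.1 h).1)]
    rfl
  have hst : ∀ i j, j ≠ i → st ((simp a).erase (i, a i)) j = a j := by
    intro i j hj
    have hex : ∃ x, (j, x) ∈ (simp a).erase (i, a i) := ⟨a j, by
      simp [mem_simp, hj]⟩
    simp only [st, hex, dif_pos]
    have := Finset.mem_of_mem_erase hex.choose_spec
    rw [mem_simp] at this
    exact this
  have h2 : ∀ i, g ((simp a).erase (i, a i)) =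
      ∑ ε : Finset (Fin k) with ε.Nonempty ∧ m ε = i, F (ε.piecewise b a) := by
    intro i
    have hfil : ∀ ε : Finset (Fin k), (m ε ∉ ((simp a).erase (i, a i)).image Prod.fst) ↔ m ε = i := by
      intro ε
      simp only [Finset.mem_image, Finset.mem_erase, mem_simp, not_exists, not_and]
      constructor
      · intro h
        by_contra hne
        exact h (m ε, a (m ε)) ⟨fun e => hne (Prod.ext_iff.1 e).1, rfl⟩ rfl
      · rintro h ⟨j, y⟩ ⟨h1, h2⟩ h3
        simp only at h1 h2 h3
        subst h3
        subst h2
        exact h1 (by rw [h])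
    simp only [g, hfil]
    refine Finset.sum_congr rfl fun ε hε => ?_
    obtain ⟨_, hne, rfl⟩ := Finset.mem_filter.1 hε
    congr 1
    funext j
    by_cases hj : j ∈ ε
    · simp [hj]
    · have : j ≠ m ε := fun e => hj (e ▸ hm ε hne)
      simp [hj, hst _ _ this]
  have h3 : dl g (simp a) = ∑ ε : Finset (Fin k) with ε.Nonempty, F (ε.piecewise b a) := by
    rw [h1, Finset.sum_congr rfl fun i _ => h2 i]
    rw [← Finset.sum_fiberwise (Finset.univ.filter fun ε : Finset (Fin k) => ε.Nonempty) m]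
    refine Finset.sum_congr rfl fun i _ => ?_
    rw [Finset.filter_filter]
  have h4 : oct b F a = F a + dl g (simp a) := by
    unfold oct
    rw [h3, ← Finset.sum_filter_add_sum_filter_not _ (fun ε : Finset (Fin k) => ε.Nonempty), add_comm]
    congr 1
    have : (Finset.univ.filter fun ε : Finset (Fin k) => ¬ ε.Nonempty) = {∅} := by
      ext ε; simp
    rw [this]
    simp
  rw [ha] at h4
  have h5 : F a + dl g (simp a) + dl g (simp a) = dl g (simp a) := by rw [← h4, zero_add]
  rwa [add_assoc, z2, add_zero] at h5
end count

lemma exists_pos {E : Type*} [NormedAddCommGroup E] [InnerProductSpace ℝ E]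
    [FiniteDimensional ℝ E] {S : Set E} (hS : S.Finite) (h : (0 : E) ∉ convexHull ℝ S) :
    ∃ w : E, ∀ x ∈ S, 0 < inner ℝ w x := by
  have : CompleteSpace E := FiniteDimensional.complete ℝ E
  have hcl : IsClosed (convexHull ℝ S) := (Set.Finite.isCompact_convexHull (𝕜 := ℝ) hS).isClosed
  obtain ⟨f, u, h1, h2⟩ := geometric_hahn_banach_point_closed (convex_convexHull ℝ S) hcl h
  refine ⟨(InnerProductSpace.toDual ℝ E).symm f, fun x hx => ?_⟩
  rw [InnerProductSpace.toDual_symm_apply]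
  have := h2 x (subset_convexHull ℝ _ hx)
  simp at h1
  linarith

lemma not_mem_of_pos {E : Type*} [NormedAddCommGroup E] [InnerProductSpace ℝ E]
    {S : Set E} {w : E} (h : ∀ x ∈ S, 0 < inner ℝ w x) : (0 : E) ∉ convexHull ℝ S := by
  intro h0
  have hconv : Convex ℝ {x : E | 0 < inner ℝ w x} :=
    convex_halfSpace_gt (innerSL ℝ w).toLinearMap.isLinear 0
  have : (0 : E) ∈ {x : E | 0 < inner ℝ w x} := convexHull_min (s := S) (fun x hx => h x hx) hconv h0
  simp at this

end CSD

/-- **Upper bound on colorful simplicial depth.** For a centered colorful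
configuration `C 0, …, C d` in `ℝ^d` in relative general position with
`|C i| ≥ 2`, the number of hitting simplices (transversals whose convex hull
contains the origin) is at most `1 + ∏ (|C i| - 1)`. -/
theorem csd_upper_bound (d : ℕ)
    (C : Fin (d + 1) → Finset (EuclideanSpace ℝ (Fin d)))
    (hcard : ∀ i, 2 ≤ (C i).card)
    (hcent : ∀ i, (0 : EuclideanSpace ℝ (Fin d)) ∈
      intrinsicInterior ℝ (convexHull ℝ (C i : Set (EuclideanSpace ℝ (Fin d)))))
    (hgen : ∀ s : Fin (d + 1) → EuclideanSpace ℝ (Fin d), (∀ i, s i ∈ C i) →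
      ∀ t : Finset (Fin (d + 1)), t.card ≤ d →
        (0 : EuclideanSpace ℝ (Fin d)) ∉ convexHull ℝ (s '' ↑t)) :
    Nat.card {s : Fin (d + 1) → EuclideanSpace ℝ (Fin d) //
        (∀ i, s i ∈ C i) ∧ (0 : EuclideanSpace ℝ (Fin d)) ∈ convexHull ℝ (Set.range s)}
      ≤ 1 + ∏ i, ((C i).card - 1) := by
  classical
  let P : Finset (Fin (d + 1) × EuclideanSpace ℝ (Fin d)) :=
    Finset.univ.biUnion fun i => (C i).image (Prod.mk i)
  have hP : ∀ p, p ∈ P ↔ p.2 ∈ C p.1 := by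
    rintro ⟨i, x⟩
    simp [P]
  have hc : CSD.Cent P := by
    intro w p hp hw
    obtain ⟨y, hy, hpos⟩ := CSD.centered_pos (hcent p.1) (Finset.mem_coe.2 ((hP p).1 hp)) hw
    exact ⟨(p.1, y), (hP _).2 hy, rfl, hpos⟩
  have h0 : ∀ i, (0 : EuclideanSpace ℝ (Fin d)) ∈ convexHull ℝ (C i : Set _) :=
    fun i => intrinsicInterior_subset (hcent i)
  have hnd : ∀ L : Submodule ℝ (EuclideanSpace ℝ (Fin d)), 1 ≤ Module.finrank ℝ L →
      Module.finrank ℝ L + 1 ≤ (CSD.nd P L).card := by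
    intro L hL
    by_contra! hlt
    have hfr := L.finrank_add_finrank_orthogonal
    rw [finrank_euclideanSpace_fin] at hfr
    have hcompl := Finset.card_compl (CSD.nd P L)
    rw [Fintype.card_fin] at hcompl
    obtain ⟨I, hI, hIc⟩ := Finset.exists_subset_card_eq (s := (CSD.nd P L)ᶜ)
      (n := Module.finrank ℝ Lᗮ + 1) (by omega)
    obtain ⟨s, hs, hs0⟩ := CSD.colorful_caratheodory C h0 Lᗮ I (by
      intro i hi x hx
      rw [Submodule.mem_orthogonal]
      intro u hu
      by_contra hne
      refine Finset.mem_compl.1 (hI hi) ?_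
      unfold CSD.nd
      exact Finset.mem_image.2 ⟨(i, x), Finset.mem_filter.2 ⟨(hP _).2 hx, u, hu, hne⟩, rfl⟩)
      (by omega)
    exact hgen s hs I (by omega) hs0
  have hone := CSD.one_main P hc hnd d ⊤ (by simp)
  have hne : ∀ i, ∃ x, x ∈ C i := fun i => Finset.card_pos.1 (by have := hcard i; omega)
  choose b hb using hne
  let H : Finset (Fin (d + 1) → EuclideanSpace ℝ (Fin d)) :=
    (Fintype.piFinset C).filter fun s => (0 : EuclideanSpace ℝ (Fin d)) ∈ convexHull ℝ (Set.range s)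
  have hH : ∀ s, s ∈ H ↔ (∀ i, s i ∈ C i) ∧
      (0 : EuclideanSpace ℝ (Fin d)) ∈ convexHull ℝ (Set.range s) := by
    intro s; simp [H, Fintype.mem_piFinset]
  have hHcard : Nat.card {s : Fin (d + 1) → EuclideanSpace ℝ (Fin d) //
        (∀ i, s i ∈ C i) ∧ (0 : EuclideanSpace ℝ (Fin d)) ∈ convexHull ℝ (Set.range s)} = H.card := by
    rw [Nat.subtype_card H hH]
  rw [hHcard]
  let B := Fintype.piFinset fun i => (C i).erase (b i)
  let ext : (H → ZMod 2) → (Fin (d + 1) → EuclideanSpace ℝ (Fin d)) → ZMod 2 :=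
    fun f s => if h : s ∈ H then f ⟨s, h⟩ else 0
  have ext_add : ∀ f g s, ext (f + g) s = ext f s + ext g s := by
    intro f g s; by_cases h : s ∈ H <;> simp [ext, h]
  let Φ : (H → ZMod 2) →ₗ[ZMod 2] (B → ZMod 2) :=
    { toFun := fun f a => CSD.oct b (ext f) a.1
      map_add' := by
        intro f g; funext a
        simp only [CSD.oct, ext_add, Pi.add_apply, Finset.sum_add_distrib]
      map_smul' := by
        intro c f; funext a
        simp only [CSD.oct, Pi.smul_apply, Finset.smul_sum, RingHom.id_apply]
        refine Finset.sum_congr rfl fun ε _ => ?_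
        by_cases h : ε.piecewise b a.1 ∈ H <;> simp [ext, h] }
  -- elements of the kernel are coboundaries of cocycles
  have hker : ∀ f, Φ f = 0 → ∃ g, (∀ a, (∀ i, a i ∈ C i) → ext f a = CSD.dl g (CSD.simp a)) := by
    intro f hf
    obtain ⟨g, hg⟩ := CSD.exists_cob b (ext f)
    refine ⟨g, fun a ha => hg a ?_⟩
    by_cases h : ∃ i, a i = b i
    · obtain ⟨i, hi⟩ := h
      exact CSD.oct_eq_zero b _ a i hi
    · push Not at h
      exact congrFun hf ⟨a, Fintype.mem_piFinset.2 fun i => Finset.mem_erase.2 ⟨h i, ha i⟩⟩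
  have hcoc : ∀ (F : (Fin (d + 1) → EuclideanSpace ℝ (Fin d)) → ZMod 2) g,
      (∀ s, s ∉ H → F s = 0) →
      (∀ a, (∀ i, a i ∈ C i) → F a = CSD.dl g (CSD.simp a)) →
      CSD.Coc (CSD.Av P ⊤ Set.univ) d g := by
    rintro F g hF hg σ ⟨⟨hcol, hsub⟩, w, _, _, hw⟩ hn
    have himg : σ.image Prod.fst = Finset.univ := by
      apply Finset.eq_univ_of_card
      rw [Finset.card_image_of_injOn (fun u hu v hv h => hcol u hu v hv h), hn, Fintype.card_fin]
    have hex : ∀ i, ∃ x, (i, x) ∈ σ := by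
      intro i
      have : i ∈ σ.image Prod.fst := himg ▸ Finset.mem_univ i
      obtain ⟨⟨j, x⟩, hp, rfl⟩ := Finset.mem_image.1 this
      exact ⟨x, hp⟩
    choose a ha using hex
    have hσ : CSD.simp a = σ := by
      apply Finset.eq_of_subset_of_card_le
      · intro p hp
        rw [CSD.mem_simp] at hp
        have := ha p.1
        rwa [← hp] at this
      · rw [hn, CSD.card_simp]
    rw [← hσ, ← hg a (fun i => (hP _).1 (hsub (ha i)))]
    refine hF a fun hh => ?_
    refine CSD.not_mem_of_pos (w := w) ?_ ((hH a).1 hh).2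
    rintro _ ⟨i, rfl⟩
    exact hw _ (ha i)
  have hzero : ∀ (F : (Fin (d + 1) → EuclideanSpace ℝ (Fin d)) → ZMod 2) g,
      (∀ a, (∀ i, a i ∈ C i) → F a = CSD.dl g (CSD.simp a)) →
      CSD.Cob (CSD.Av P ⊤ Set.univ) d g → ∀ a, (∀ i, a i ∈ C i) → F a = 0 := by
    rintro F g hg ⟨χ, hχ⟩ a ha
    rw [hg a ha, ← CSD.dl_dl χ (CSD.simp a)]
    refine CSD.dl_congr fun v hv => hχ _ ?_ ?_
    · have hva := (CSD.mem_simp a v).1 hv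
      obtain ⟨w, hw⟩ := CSD.exists_pos ((Finset.finite_toSet (Finset.univ.erase v.1)).image a)
        (hgen a ha (Finset.univ.erase v.1) (by simp))
      refine ⟨⟨?_, ?_⟩, w, trivial, trivial, ?_⟩
      · intro p hp q hq e
        have hp' := (CSD.mem_simp a p).1 (Finset.mem_of_mem_erase hp)
        have hq' := (CSD.mem_simp a q).1 (Finset.mem_of_mem_erase hq)
        exact Prod.ext e (by rw [hp', hq', e])
      · intro p hp
        have hp' := (CSD.mem_simp a p).1 (Finset.mem_of_mem_erase hp)
        rw [hP, hp']
        exact ha _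
      · intro p hp
        have hp' := (CSD.mem_simp a p).1 (Finset.mem_of_mem_erase hp)
        refine hw _ ⟨p.1, ?_, hp'.symm⟩
        refine Finset.mem_coe.2 (Finset.mem_erase.2 ⟨fun e => ?_, Finset.mem_univ _⟩)
        exact (Finset.mem_erase.1 hp).1 (Prod.ext e (by rw [hp', hva, e]))
    · rw [Finset.card_erase_of_mem hv, CSD.card_simp]; rfl
  have hext0 : ∀ f, (∀ a, (∀ i, a i ∈ C i) → ext f a = 0) → f = 0 := by
    intro f h
    funext s
    have := h s.1 ((hH s.1).1 s.2).1
    simpa [ext, s.2] using this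
  have hextH : ∀ f s, s ∉ H → ext f s = 0 := by
    intro f s h; simp [ext, h]
  have hthree : ∀ f f', Φ f = 0 → Φ f' = 0 → f = 0 ∨ f' = 0 ∨ f + f' = 0 := by
    intro f f' hf hf'
    obtain ⟨g, hg⟩ := hker f hf
    obtain ⟨g', hg'⟩ := hker f' hf'
    rcases hone g g' (hcoc _ g (hextH f) hg) (hcoc _ g' (hextH f') hg') with h | h | h
    · exact Or.inl (hext0 _ (hzero _ g hg h))
    · exact Or.inr (Or.inl (hext0 _ (hzero _ g' hg' h)))
    · refine Or.inr (Or.inr (hext0 _ (hzero _ _ ?_ h)))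
      intro a ha
      rw [ext_add, CSD.dl_add, hg a ha, hg' a ha]
  have hkerrank : Module.finrank (ZMod 2) (LinearMap.ker Φ) ≤ 1 := by
    by_cases hv : ∃ v : LinearMap.ker Φ, v ≠ 0
    · obtain ⟨v, hv⟩ := hv
      refine finrank_le_one v fun w => ?_
      rcases hthree v.1 w.1 v.2 w.2 with h | h | h
      · exact absurd (Subtype.ext h) hv
      · exact ⟨0, by rw [zero_smul]; exact (Subtype.ext h).symm⟩
      · refine ⟨1, ?_⟩
        rw [one_smul]
        apply Subtype.ext
        funext s
        have := congrFun h s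
        simp only [Pi.add_apply, Pi.zero_apply] at this
        rwa [← CharTwo.sub_eq_add, sub_eq_zero] at this
    · push Not at hv
      exact finrank_le_one 0 fun w => ⟨0, by rw [hv w, zero_smul]⟩
  have hrange : Module.finrank (ZMod 2) (LinearMap.range Φ) ≤ B.card := by
    have := Submodule.finrank_le (LinearMap.range Φ)
    rwa [Module.finrank_fintype_fun_eq_card, Fintype.card_coe] at this
  have hrn := Φ.finrank_range_add_finrank_ker
  rw [Module.finrank_fintype_fun_eq_card, Fintype.card_coe] at hrn
  have hB : B.card = ∏ i, ((C i).card - 1) := by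
    rw [Fintype.card_piFinset]
    exact Finset.prod_congr rfl fun i _ => Finset.card_erase_of_mem (hb i)
  omega
end

section
/- Let P ⊂ R^d be a full-dimensional polytope with 0 in its interior, facet inequalities ℓ_i(x) ≤ 1 for i ∈ [m], and let π : R^d → R^e be a linear projection with associated P-transform G_P. For a proper face F of P, the image π(F) is a proper face of π(P) with π^{-1}(π(F)) ∩ P = F if and only if 0 ∈ relint conv G_P(I(F)), where I(F) = {i : ℓ_i ≡ 1 on F}. -/
open Finset

/-- `F` is a face of the convex set `S`: the set of maximizers of some linear
functional over `S`. -/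
def IsFaceOf {W : Type*} [AddCommGroup W] [Module ℝ W] (S F : Set W) : Prop :=
  ∃ g : W →ₗ[ℝ] ℝ, F = {x ∈ S | ∀ y ∈ S, g y ≤ g x}

theorem farkas_aux {V ι : Type*} [AddCommGroup V] [Module ℝ V] [DecidableEq ι] (s : Finset ι) :
    ∀ (a : ι → V →ₗ[ℝ] ℝ) (b : V →ₗ[ℝ] ℝ),
      (∀ x, (∀ i ∈ s, a i x ≤ 0) → b x ≤ 0) →
      ∃ c : ι → ℝ, (∀ i, 0 ≤ c i) ∧ b = ∑ i ∈ s, c i • a i := by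
  induction s using Finset.induction_on with
  | empty =>
    intro a b h
    refine ⟨0, fun _ => le_rfl, ?_⟩
    ext x
    have h1 := h x (by simp)
    have h2 := h (-x) (by simp)
    simp at h2 ⊢
    linarith
  | insert n s hn ih =>
    intro a b h
    by_cases hb : ∀ x, (∀ i ∈ s, a i x ≤ 0) → b x ≤ 0
    · obtain ⟨c, hc, hbc⟩ := ih a b hb
      refine ⟨fun i => if i = n then 0 else c i, ?_, ?_⟩
      · intro i
        dsimp only
        split_ifs
        · exact le_rfl
        · exact hc i
      · rw [Finset.sum_insert hn, hbc]
        simp only [if_true, zero_smul, zero_add]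
        refine Finset.sum_congr rfl fun i hi => ?_
        rw [if_neg (fun hin : i = n => hn (hin ▸ hi))]
    · push Not at hb
      obtain ⟨x0, hx0, hbx0⟩ := hb
      have han : 0 < a n x0 := by
        by_contra hcon
        push Not at hcon
        have := h x0 (by
          intro i hi
          rcases Finset.mem_insert.1 hi with rfl | hi
          · exact hcon
          · exact hx0 i hi)
        linarith
      obtain ⟨c, hc, hbc⟩ := ih (fun i => a i - (a i x0 / a n x0) • a n)
        (b - (b x0 / a n x0) • a n) (by
          intro x hx
          have := h (x - (a n x / a n x0) • x0) (by
            intro i hi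
            rcases Finset.mem_insert.1 hi with rfl | hi
            · simp only [map_sub, map_smul, smul_eq_mul]
              rw [div_mul_cancel₀ _ han.ne']; simp
            · have := hx i hi
              simp only [map_sub, map_smul, smul_eq_mul, LinearMap.sub_apply,
                LinearMap.smul_apply] at this ⊢
              convert this using 2
              ring)
          simp only [map_sub, map_smul, smul_eq_mul, LinearMap.sub_apply,
                LinearMap.smul_apply] at this ⊢
          convert this using 2
          ring)
      refine ⟨fun i => if i = n then b x0 / a n x0 - ∑ j ∈ s, c j * (a j x0 / a n x0) else c i,
        ?_, ?_⟩
      · intro i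
        dsimp only
        split_ifs
        · have h1 : 0 ≤ b x0 / a n x0 := by positivity
          have h2 : ∑ j ∈ s, c j * (a j x0 / a n x0) ≤ 0 := by
            refine Finset.sum_nonpos fun j hj => ?_
            exact mul_nonpos_of_nonneg_of_nonpos (hc j)
              (div_nonpos_of_nonpos_of_nonneg (hx0 j hj) han.le)
          linarith
        · exact hc i
      · rw [Finset.sum_insert hn]
        simp only [if_true]
        have h3 : ∑ i ∈ s, (if i = n then b x0 / a n x0 - ∑ j ∈ s, c j * (a j x0 / a n x0)
            else c i) • a i = ∑ i ∈ s, c i • a i := by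
          refine Finset.sum_congr rfl fun i hi => ?_
          rw [if_neg (fun hin : i = n => hn (hin ▸ hi))]
        rw [h3]
        have h4 : b = (b x0 / a n x0) • a n +
          ∑ i ∈ s, c i • (a i - (a i x0 / a n x0) • a n) := by
          rw [← hbc]; abel
        conv_lhs => rw [h4]
        ext x
        simp only [LinearMap.add_apply, LinearMap.sum_apply, LinearMap.smul_apply,
          LinearMap.sub_apply, smul_eq_mul, mul_sub, sub_mul, Finset.sum_sub_distrib,
          Finset.sum_mul, mul_assoc]
        ring

open Topology in
theorem zero_mem_relint_iff {W ι : Type*} [NormedAddCommGroup W] [NormedSpace ℝ W]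
    [FiniteDimensional ℝ W] {s : Set W} :
    (0 : W) ∈ intrinsicInterior ℝ s ↔ (0 : W) ∈ s ∧ s ∈ 𝓝[(affineSpan ℝ s : Set W)] 0 := by
  rw [mem_intrinsicInterior]
  constructor
  · rintro ⟨y, hy, hy0⟩
    have h1 := mem_interior_iff_mem_nhds.1 hy
    have h1 := (preimage_coe_mem_nhds_subtype (s := (affineSpan ℝ s : Set W))).1 h1
    rw [hy0] at h1
    have := interior_subset hy
    rw [Set.mem_preimage, hy0] at this
    exact ⟨this, h1⟩
  · rintro ⟨h0, h1⟩
    refine ⟨⟨0, subset_affineSpan ℝ s h0⟩, ?_, rfl⟩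
    rw [mem_interior_iff_mem_nhds]
    exact (preimage_coe_mem_nhds_subtype (s := (affineSpan ℝ s : Set W))).2 h1

open Topology in
theorem relint_conv_iff {W ι : Type*} [NormedAddCommGroup W] [NormedSpace ℝ W]
    [FiniteDimensional ℝ W] [Fintype ι] [DecidableEq ι] (G : ι → W) (s : Finset ι) (hs : s.Nonempty) :
    (0 : W) ∈ intrinsicInterior ℝ (convexHull ℝ (G '' (s : Set ι))) ↔
      ∃ c : ι → ℝ, (∀ i ∈ s, 0 < c i) ∧ ∑ i ∈ s, c i • G i = 0 := by
  rw [zero_mem_relint_iff (ι := ι)]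
  constructor
  · rintro ⟨h0, h1⟩
    have hmem : ∀ x ∈ convexHull ℝ (G '' (s : Set ι)),
        ∃ w : ι → ℝ, (∀ i, 0 ≤ w i) ∧ ∑ i ∈ s, w i • G i = x := by
      intro x hx
      have : convexHull ℝ (G '' (s : Set ι)) ⊆
          {x | ∃ w : ι → ℝ, (∀ i, 0 ≤ w i) ∧ ∑ i ∈ s, w i • G i = x} := by
        refine convexHull_min ?_ ?_
        · rintro _ ⟨i, hi, rfl⟩
          refine ⟨Pi.single i 1, fun j => ?_, ?_⟩
          · by_cases h : j = i
            · subst h; simp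
            · simp [h]
          · rw [Finset.sum_eq_single i]
            · simp
            · intro j _ h; simp [h]
            · intro h; exact absurd hi h
        · rintro _ ⟨w, hw, rfl⟩ _ ⟨v, hv, rfl⟩ a b ha hb _
          refine ⟨fun i => a * w i + b * v i, fun i => ?_, ?_⟩
          · have := hw i; have := hv i; positivity
          · simp only [add_smul, Finset.sum_add_distrib, Finset.smul_sum, smul_smul]
      exact this hx
    have key : ∀ j ∈ s, ∃ w : ι → ℝ, (∀ i, 0 ≤ w i) ∧ 0 < w j ∧ ∑ i ∈ s, w i • G i = 0 := by
      intro j hj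
      have hGj : G j ∈ affineSpan ℝ (convexHull ℝ (G '' (s : Set ι))) :=
        subset_affineSpan ℝ _ (subset_convexHull ℝ _ ⟨j, hj, rfl⟩)
      have hz := subset_affineSpan ℝ _ h0
      have ht : Filter.Tendsto (fun t : ℝ => (-t) • G j) (𝓝 0)
          (𝓝[(affineSpan ℝ (convexHull ℝ (G '' (s : Set ι))) : Set W)] 0) := by
        refine tendsto_nhdsWithin_iff.2 ⟨?_, Filter.Eventually.of_forall fun t => ?_⟩
        · have : Continuous (fun t : ℝ => (-t) • G j) := by fun_prop
          simpa using this.tendsto 0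
        · have := AffineMap.lineMap_mem (-t) hz hGj
          simpa [AffineMap.lineMap_apply] using this
      have hev := (ht.eventually h1)
      have hev' : ∀ᶠ t in 𝓝[>] (0:ℝ), (-t) • G j ∈ convexHull ℝ (G '' (s : Set ι)) :=
        hev.filter_mono nhdsWithin_le_nhds
      obtain ⟨t, ht1, ht2⟩ := (hev'.and self_mem_nhdsWithin).exists
      have ht2 : 0 < t := ht2
      obtain ⟨w, hw, hwx⟩ := hmem _ ht1
      refine ⟨fun i => w i + (if i = j then t else 0), fun i => ?_, ?_, ?_⟩
      · have := hw i
        dsimp only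
        split_ifs <;> linarith
      · have := hw j
        simp; linarith
      · simp only [add_smul, Finset.sum_add_distrib, hwx, ite_smul, zero_smul,
          Finset.sum_ite_eq', if_pos hj]
        simp
    choose! w hw hwj hwx using key
    refine ⟨fun i => ∑ j ∈ s, w j i, fun i hi => ?_, ?_⟩
    · exact Finset.sum_pos' (fun j hj => hw j hj i) ⟨i, hi, hwj i hi⟩
    · simp only [Finset.sum_smul]
      rw [Finset.sum_comm]
      exact Finset.sum_eq_zero fun j hj => hwx j hj
  · rintro ⟨c, hc, hcx⟩
    have hS : 0 < ∑ i ∈ s, c i := Finset.sum_pos hc hs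
    have h0 : (0 : W) ∈ convexHull ℝ (G '' (s : Set ι)) := by
      have := (convex_convexHull ℝ (G '' (s : Set ι))).centerMass_mem (t := s) (w := c) (z := G)
        (fun i hi => (hc i hi).le) hS
        (fun i hi => subset_convexHull ℝ _ ⟨i, hi, rfl⟩)
      simpa [Finset.centerMass, hcx] using this
    refine ⟨h0, ?_⟩
    -- the linear map
    let Φ : (ι → ℝ) →ₗ[ℝ] W := ∑ i ∈ s, (LinearMap.proj i : (ι → ℝ) →ₗ[ℝ] ℝ).smulRight (G i)
    have hΦ : ∀ w, Φ w = ∑ i ∈ s, w i • G i := by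
      intro w; simp [Φ, LinearMap.sum_apply]
    have hsub : (affineSpan ℝ (convexHull ℝ (G '' (s : Set ι))) : Set W) ⊆ (LinearMap.range Φ : Set W) := by
      have : affineSpan ℝ (convexHull ℝ (G '' (s : Set ι))) ≤ (LinearMap.range Φ).toAffineSubspace := by
        rw [affineSpan_convexHull, affineSpan_le]
        rintro _ ⟨i, hi, rfl⟩
        refine ⟨Pi.single i 1, ?_⟩
        rw [hΦ, Finset.sum_eq_single i]
        · simp
        · intro j _ h; simp [h]
        · intro h; exact absurd hi h
      exact this
    refine nhdsWithin_mono _ hsub ?_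
    have hopen : IsOpenMap Φ.rangeRestrict :=
      LinearMap.isOpenMap_of_finiteDimensional _ (LinearMap.surjective_rangeRestrict Φ)
    have hU : {w : ι → ℝ | (∀ i ∈ s, 0 < w i + c i) ∧ 0 < ∑ i ∈ s, c i + (∑ i ∈ s, c i - ∑ i ∈ s, (w i + c i))} ∈ 𝓝 (0 : ι → ℝ) := by
      refine IsOpen.mem_nhds ?_ ?_
      · have e : {w : ι → ℝ | (∀ i ∈ s, 0 < w i + c i) ∧ 0 < ∑ i ∈ s, c i + (∑ i ∈ s, c i - ∑ i ∈ s, (w i + c i))} = (⋂ i ∈ s, {w : ι → ℝ | 0 < w i + c i}) ∩ {w | 0 < ∑ i ∈ s, c i + (∑ i ∈ s, c i - ∑ i ∈ s, (w i + c i))} := by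
          ext w; simp
        rw [e]
        refine IsOpen.inter (isOpen_biInter_finset fun i _ => ?_) ?_
        · exact isOpen_lt (by fun_prop) (by fun_prop)
        · exact isOpen_lt (by fun_prop) (by fun_prop)
      · refine ⟨fun i hi => by simpa using hc i hi, by simpa using hS⟩
    have himg := hopen.image_mem_nhds hU
    have hpre : ((↑) ⁻¹' {x : W | (1 / (2 * ∑ i ∈ s, c i)) • x ∈ convexHull ℝ (G '' (s : Set ι))} : Set (LinearMap.range Φ)) ∈ 𝓝 (Φ.rangeRestrict 0) := by
      refine Filter.mem_of_superset himg ?_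
      rintro _ ⟨w, ⟨hw1, hw2⟩, rfl⟩
      have e1 : ((Φ.rangeRestrict w : LinearMap.range Φ) : W) = ∑ i ∈ s, (w i + c i) • G i := by
        simp only [add_smul, Finset.sum_add_distrib, hcx]
        simp [hΦ]
      have hT : 0 < ∑ i ∈ s, (w i + c i) := Finset.sum_pos hw1 hs
      have hm := (convex_convexHull ℝ (G '' (s : Set ι))).centerMass_mem (t := s)
        (w := fun i => w i + c i) (z := G)
        (fun i hi => (hw1 i hi).le) hT
        (fun i hi => subset_convexHull ℝ _ ⟨i, hi, rfl⟩)
      rw [Finset.centerMass] at hm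
      have := (convex_convexHull ℝ (G '' (s : Set ι))).smul_mem_of_zero_mem h0 hm
        (t := (∑ i ∈ s, (w i + c i)) / (2 * ∑ i ∈ s, c i))
        ⟨by positivity, by rw [div_le_one (by positivity)]; linarith⟩
      rw [Set.mem_preimage, Set.mem_setOf_eq, e1]
      rw [smul_smul] at this
      convert this using 2
      field_simp
    rw [map_zero] at hpre
    have hpre := (preimage_coe_mem_nhds_subtype (s := (LinearMap.range Φ : Set W))).1 hpre
    have hpre : {x : W | (1 / (2 * ∑ i ∈ s, c i)) • x ∈ convexHull ℝ (G '' (s : Set ι))} ∈ 𝓝[(LinearMap.range Φ : Set W)] 0 := hpre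
    have ht : Filter.Tendsto (fun x : W => (2 * ∑ i ∈ s, c i) • x)
        (𝓝[(LinearMap.range Φ : Set W)] 0) (𝓝[(LinearMap.range Φ : Set W)] 0) := by
      refine tendsto_nhdsWithin_iff.2 ⟨?_, ?_⟩
      · have : Continuous (fun x : W => (2 * ∑ i ∈ s, c i) • x) := by fun_prop
        have := this.tendsto 0
        rw [smul_zero] at this
        exact this.mono_left nhdsWithin_le_nhds
      · filter_upwards [self_mem_nhdsWithin] with x hx
        exact (LinearMap.range Φ).smul_mem _ hx
    filter_upwards [ht hpre] with x hx
    simp only [Set.mem_preimage, Set.mem_setOf_eq, smul_smul] at hx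
    rwa [one_div_mul_cancel (by positivity), one_smul] at hx

/-- **Faces of projections via the `P`-transform.** Let `P ⊆ ℝ^d` be a
full-dimensional polytope with `0` in its interior, given by facet inequalities
`ℓ i x ≤ 1`, let `π : ℝ^d → ℝ^e` be a surjective linear projection and `G` the
associated `P`-transform (characterized by: `∑ c i • G i = 0` iff `∑ c i • ℓ i`
lies in the image of `π*`). For a proper face `F` of `P`, the image `π(F)` is a
proper face of `π(P)` with `π⁻¹(π(F)) ∩ P = F` if and only if
`0 ∈ relint conv G(I(F))`, where `I(F) = {i : ℓ i ≡ 1 on F}`. -/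
theorem ptransform_faces (d e m : ℕ)
    (L : Fin (m + 1) → Module.Dual ℝ (EuclideanSpace ℝ (Fin d)))
    (P : Set (EuclideanSpace ℝ (Fin d)))
    (hP : P = {x | ∀ i, L i x ≤ 1})
    (hPbdd : Bornology.IsBounded P)
    (h0 : (0 : EuclideanSpace ℝ (Fin d)) ∈ interior P)
    (π : EuclideanSpace ℝ (Fin d) →ₗ[ℝ] EuclideanSpace ℝ (Fin e))
    (hπ : Function.Surjective π)
    (G : Fin (m + 1) → EuclideanSpace ℝ (Fin (d - e)))
    (hG : ∀ c : Fin (m + 1) → ℝ,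
      (∑ i, c i • G i = 0) ↔ (∑ i, c i • L i) ∈ LinearMap.range π.dualMap)
    (F : Set (EuclideanSpace ℝ (Fin d)))
    (hF : IsFaceOf P F) (hFne : F.Nonempty) (hFproper : F ≠ P) :
    (IsFaceOf (π '' P) (π '' F) ∧ π '' F ≠ π '' P ∧ π ⁻¹' (π '' F) ∩ P = F) ↔
      (0 : EuclideanSpace ℝ (Fin (d - e))) ∈
        intrinsicInterior ℝ (convexHull ℝ (G '' {i | ∀ x ∈ F, L i x = 1})) := by
  classical
  obtain ⟨g, hg⟩ := hF
  set s : Finset (Fin (m + 1)) := Finset.univ.filter (fun i => ∀ x ∈ F, L i x = 1) with hsdef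
  have hmems : ∀ i, i ∈ s ↔ ∀ x ∈ F, L i x = 1 := by intro i; simp [hsdef]
  have hset : {i | ∀ x ∈ F, L i x = 1} = (s : Set (Fin (m + 1))) := by
    ext i; simp [hsdef]
  rw [hset]
  have hmP : ∀ x, x ∈ P ↔ ∀ i, L i x ≤ 1 := by intro x; rw [hP]; rfl
  have hFP : ∀ x ∈ F, x ∈ P := by intro x hx; rw [hg] at hx; exact hx.1
  have hFmax : ∀ x ∈ F, ∀ y ∈ P, g y ≤ g x := by intro x hx; rw [hg] at hx; exact hx.2
  -- a relative interior point of F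
  obtain ⟨p, hpF, hp⟩ : ∃ p ∈ F, ∀ i, i ∉ s → L i p < 1 := by
    have hex : ∀ i, ∃ x ∈ F, i ∉ s → L i x < 1 := by
      intro i
      by_cases hi : i ∈ s
      · obtain ⟨x, hx⟩ := hFne
        exact ⟨x, hx, fun h => absurd hi h⟩
      · have := hi
        rw [hmems] at this
        push Not at this
        obtain ⟨x, hx, hne⟩ := this
        exact ⟨x, hx, fun _ => lt_of_le_of_ne ((hmP x).1 (hFP x hx) i) hne⟩
    choose x hxF hx using hex
    have hm : (0:ℝ) < m + 1 := by positivity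
    have hlin : ∀ f : EuclideanSpace ℝ (Fin d) →ₗ[ℝ] ℝ,
        f ((1 / ((m:ℝ) + 1)) • ∑ i, x i) = (∑ i, f (x i)) / (m + 1) := by
      intro f
      rw [map_smul, map_sum, smul_eq_mul]; ring
    have hq : ((1 / ((m:ℝ) + 1)) • ∑ i, x i) ∈ P := by
      rw [hmP]
      intro j
      rw [hlin, div_le_one hm]
      calc ∑ i, L j (x i) ≤ ∑ i : Fin (m+1), (1:ℝ) :=
            Finset.sum_le_sum fun i _ => (hmP _).1 (hFP _ (hxF i)) j
        _ = m + 1 := by simp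
    refine ⟨(1 / ((m:ℝ) + 1)) • ∑ i, x i, ?_, ?_⟩
    · rw [hg]
      refine ⟨hq, fun y hy => ?_⟩
      rw [hlin, le_div_iff₀ hm]
      calc g y * (m + 1) = ∑ i : Fin (m+1), g y := by simp; ring
        _ ≤ _ := Finset.sum_le_sum fun i _ => hFmax _ (hxF i) y hy
    · intro j hj
      rw [hlin, div_lt_one hm]
      calc ∑ i, L j (x i) < ∑ i : Fin (m+1), (1:ℝ) :=
            Finset.sum_lt_sum (fun i _ => (hmP _).1 (hFP _ (hxF i)) j)
              ⟨j, Finset.mem_univ _, hx j hj⟩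
        _ = m + 1 := by simp
  have hp1 : ∀ i ∈ s, L i p = 1 := fun i hi => (hmems i).1 hi p hpF
  -- small steps
  have hstep : ∀ v, (∀ i ∈ s, L i v ≤ 0) → ∃ δ : ℝ, 0 < δ ∧ p + δ • v ∈ P := by
    intro v hv
    have hev : ∀ᶠ δ : ℝ in nhdsWithin 0 (Set.Ioi 0), ∀ i, i ∉ s → L i p + δ * L i v < 1 := by
      rw [Filter.eventually_all]
      intro i
      by_cases hi : i ∈ s
      · exact Filter.Eventually.of_forall fun δ h => absurd hi h
      · have hcont : Continuous (fun δ : ℝ => L i p + δ * L i v) := by fun_prop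
        have := (hcont.tendsto 0).eventually (gt_mem_nhds (show L i p + 0 * L i v < 1 by simpa using hp i hi))
        exact (this.filter_mono nhdsWithin_le_nhds).mono fun δ h _ => h
    obtain ⟨δ, h1, h2⟩ := (hev.and self_mem_nhdsWithin).exists
    have h2 : 0 < δ := h2
    refine ⟨δ, h2, (hmP _).2 fun i => ?_⟩
    rw [map_add, map_smul, smul_eq_mul]
    by_cases hi : i ∈ s
    · rw [hp1 i hi]
      have := mul_nonpos_of_nonneg_of_nonpos h2.le (hv i hi)
      linarith
    · exact (h1 i hi).le
  -- characterization of F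
  have hchar : ∀ x ∈ P, (∀ i ∈ s, L i x = 1) → x ∈ F := by
    intro x hx hxs
    obtain ⟨δ, hδ, hδP⟩ := hstep (p - x) (fun i hi => by rw [map_sub, hp1 i hi, hxs i hi]; simp)
    have h1 := hFmax p hpF _ hδP
    rw [map_add, map_smul, smul_eq_mul, map_sub] at h1
    have h2 : g p ≤ g x := by
      by_contra hcon
      push Not at hcon
      have := mul_pos hδ (sub_pos.2 hcon)
      linarith
    rw [hg]
    exact ⟨hx, fun y hy => (hFmax p hpF y hy).trans h2⟩
  have hs : s.Nonempty := by
    by_contra hcon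
    rw [Finset.not_nonempty_iff_eq_empty] at hcon
    refine hFproper (Set.Subset.antisymm hFP fun x hx => hchar x hx ?_)
    rw [hcon]; simp
  have hext : ∀ (c : Fin (m+1) → ℝ) {M : Type} [AddCommGroup M] [Module ℝ M] (f : Fin (m+1) → M),
      ∑ i, (if i ∈ s then c i else 0) • f i = ∑ i ∈ s, c i • f i := by
    intro c M _ _ f
    simp [ite_smul, Finset.sum_ite_mem]
  have hGs : ∀ c : Fin (m+1) → ℝ, (∑ i ∈ s, c i • G i = 0) ↔
      (∑ i ∈ s, c i • L i) ∈ LinearMap.range π.dualMap := by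
    intro c
    have := hG (fun i => if i ∈ s then c i else 0)
    rwa [hext c G, hext c L] at this
  rw [relint_conv_iff G s hs]
  constructor
  · rintro ⟨⟨k, hk⟩, -, hpre⟩
    -- F is the argmax of k ∘ π
    have hmax : ∀ x ∈ P, x ∈ F ↔ ∀ y ∈ P, k (π y) ≤ k (π x) := by
      intro x hx
      constructor
      · intro hxF y hy
        have : π x ∈ π '' F := ⟨x, hxF, rfl⟩
        rw [hk] at this
        exact this.2 _ ⟨y, hy, rfl⟩
      · intro h
        rw [← hpre]
        refine ⟨?_, hx⟩
        rw [Set.mem_preimage, hk]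
        refine ⟨⟨x, hx, rfl⟩, ?_⟩
        rintro _ ⟨y, hy, rfl⟩
        exact h y hy
    have key : ∀ j ∈ s, ∃ t : ℝ, ∃ c : Fin (m+1) → ℝ, (∀ i, 0 ≤ c i) ∧ 0 < c j ∧
        t • π.dualMap k = ∑ i ∈ s, c i • L i := by
      intro j hj
      obtain ⟨c, hc, hbc⟩ := farkas_aux (insert none (s.map Function.Embedding.some))
        (fun o : Option (Fin (m+1)) => o.elim (-(π.dualMap k)) L) (-(L j)) (by
          intro x hx
          have hx1 := hx none (by simp)
          have hx2 : ∀ i ∈ s, L i x ≤ 0 := fun i hi => hx (some i) (by simp [hi])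
          simp only [Option.elim, LinearMap.neg_apply, LinearMap.dualMap_apply] at hx1
          obtain ⟨δ, hδ, hδP⟩ := hstep x hx2
          have hmem : p + δ • x ∈ F := by
            rw [hmax _ hδP]
            intro y hy
            have h1 := (hmax p (hFP p hpF)).1 hpF y hy
            have h2 : 0 ≤ δ * k (π x) := mul_nonneg hδ.le (by linarith)
            simp only [map_add, map_smul, smul_eq_mul]
            linarith
          have h3 := (hmems j).1 hj _ hmem
          rw [map_add, map_smul, smul_eq_mul, hp1 j hj] at h3
          have h4 : δ * L j x = 0 := by linarith
          rcases mul_eq_zero.1 h4 with h | h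
          · exact absurd h hδ.ne'
          · simp [h])
      rw [Finset.sum_insert (by simp), Finset.sum_map] at hbc
      simp only [Option.elim, Function.Embedding.some_apply] at hbc
      refine ⟨c none, fun i => c (some i) + if i = j then 1 else 0, fun i => ?_, ?_, ?_⟩
      · have := hc (some i)
        dsimp only
        split_ifs <;> linarith
      · have := hc (some j)
        simp; linarith
      · simp only [add_smul, Finset.sum_add_distrib, ite_smul, zero_smul, one_smul,
          Finset.sum_ite_eq', if_pos hj]
        rw [smul_neg] at hbc
        have : ∑ i ∈ s, c (some i) • L i = -(L j) + c none • π.dualMap k := by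
          rw [hbc]; abel
        rw [this]; abel
    choose! t c hc hcj hct using key
    refine ⟨fun i => ∑ j ∈ s, c j i, fun i hi => ?_, ?_⟩
    · exact Finset.sum_pos' (fun j hj => hc j hj i) ⟨i, hi, hcj i hi⟩
    · rw [hGs]
      have : ∑ i ∈ s, (∑ j ∈ s, c j i) • L i = ∑ j ∈ s, t j • π.dualMap k := by
        simp only [Finset.sum_smul]
        rw [Finset.sum_comm]
        exact Finset.sum_congr rfl fun j hj => (hct j hj).symm
      rw [this]
      exact Submodule.sum_mem _ fun j _ => Submodule.smul_mem _ _ ⟨k, rfl⟩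
  · rintro ⟨c, hc, hcx⟩
    rw [hGs] at hcx
    obtain ⟨k, hk⟩ := hcx
    have hkx : ∀ x, k (π x) = ∑ i ∈ s, c i * L i x := by
      intro x
      have := congrArg (fun f => f x) hk
      simpa [LinearMap.sum_apply] using this
    have hle : ∀ x ∈ P, k (π x) ≤ ∑ i ∈ s, c i := by
      intro x hx
      rw [hkx]
      refine Finset.sum_le_sum fun i hi => ?_
      have := mul_le_mul_of_nonneg_left ((hmP x).1 hx i) (hc i hi).le
      linarith
    have heq : ∀ x ∈ F, k (π x) = ∑ i ∈ s, c i := by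
      intro x hx
      rw [hkx]
      refine Finset.sum_congr rfl fun i hi => ?_
      rw [(hmems i).1 hi x hx, mul_one]
    have hback : ∀ x ∈ P, ∑ i ∈ s, c i ≤ k (π x) → x ∈ F := by
      intro x hx h
      refine hchar x hx fun i hi => ?_
      by_contra hne
      have hlt : L i x < 1 := lt_of_le_of_ne ((hmP x).1 hx i) hne
      have : ∑ i ∈ s, c i * L i x < ∑ i ∈ s, c i := by
        refine Finset.sum_lt_sum (fun i hi => ?_) ⟨i, hi, ?_⟩
        · have := mul_le_mul_of_nonneg_left ((hmP x).1 hx i) (hc i hi).le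
          linarith
        · have := mul_lt_mul_of_pos_left hlt (hc i hi)
          linarith
      rw [hkx] at h
      linarith
    have hpre : π ⁻¹' (π '' F) ∩ P = F := by
      ext x
      constructor
      · rintro ⟨⟨y, hy, hyx⟩, hx⟩
        refine hback x hx ?_
        rw [← hyx, heq y hy]
      · intro hx
        exact ⟨⟨x, hx, rfl⟩, hFP x hx⟩
    refine ⟨⟨k, ?_⟩, ?_, hpre⟩
    · ext z
      constructor
      · rintro ⟨x, hx, rfl⟩
        refine ⟨⟨x, hFP x hx, rfl⟩, ?_⟩
        rintro _ ⟨y, hy, rfl⟩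
        rw [heq x hx]
        exact hle y hy
      · rintro ⟨⟨x, hx, rfl⟩, h⟩
        refine ⟨x, hback x hx ?_, rfl⟩
        rw [← heq p hpF]
        exact h _ ⟨p, hFP p hpF, rfl⟩
    · intro h
      apply hFproper
      rw [← hpre, h]
      ext x
      constructor
      · exact fun hx => hx.2
      · exact fun hx => ⟨⟨x, hx, rfl⟩, hx⟩
end

section
/- Let n_0, ..., n_s ≥ 1, n = n_0 + ... + n_s, and let P_i ⊂ R^{n-s-1} be n_i-dimensional simplices whose Minkowski sum is full-dimensional. Then the number of totally mixed facets of P_0 + ... + P_s is at most 1 + n_0 n_1 ··· n_s. -/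
open Finset
open scoped Pointwise

lemma count_bound {ι : Type*} [Fintype ι] [DecidableEq ι] (n : ι → ℕ)
    (H : Finset ((i : ι) → Fin (n i + 1))) (Φ : ((i : ι) → Fin (n i + 1)) → ℝ)
    (v : ((i : ι) → Fin (n i + 1)) → ((i : ι) → Fin (n i + 1)))
    (hv : ∀ g ∈ H, ∀ i, v g i ≠ g i)
    (htri : ∀ g ∈ H, ∀ y ∈ H, y ≠ g → (∀ i, y i = g i ∨ y i = v g i) → Φ g < Φ y) :
    H.card ≤ ∏ i, n i := by
  classical
  let u : ((i : ι) → Fin (n i + 1)) → ((i : ι) → Fin (n i + 1)) → ℝ := fun g y =>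
    ∏ i, ((if y i = g i then (1 : ℝ) else 0) - (if y i = v g i then 1 else 0))
  let r : H → ((i : ι) → Fin (n i)) → ℝ := fun g x => u g.1 (fun i => (x i).succ)
  have hLI : LinearIndependent ℝ r := by
    rw [Fintype.linearIndependent_iff]
    intro α hα
    -- the combination vanishes everywhere
    have hzero : ∀ k : ℕ, ∀ x : (i : ι) → Fin (n i + 1),
        (univ.filter (fun i => x i = 0)).card = k → ∑ g : H, α g * u g.1 x = 0 := by
      intro k
      induction k with
      | zero =>
        intro x hx
        rw [Finset.card_eq_zero, Finset.filter_eq_empty_iff] at hx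
        have hx' : ∀ i, x i ≠ 0 := fun i => hx (mem_univ i)
        have := congrFun hα (fun i => (x i).pred (hx' i))
        simpa [r, Finset.sum_apply] using this
      | succ k ih =>
        intro x hx
        have hne : (univ.filter (fun i => x i = 0)).Nonempty := by
          rw [← Finset.card_pos]; omega
        obtain ⟨i, hi⟩ := hne
        have hxi : x i = 0 := (mem_filter.1 hi).2
        have hsum : ∑ j : Fin (n i + 1), ∑ g : H, α g * u g.1 (Function.update x i j) = 0 := by
          rw [Finset.sum_comm]
          apply Finset.sum_eq_zero
          intro g _
          rw [← Finset.mul_sum]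
          have : ∑ j : Fin (n i + 1), u g.1 (Function.update x i j) = 0 := by
            have h1 : ∀ j, u g.1 (Function.update x i j) =
                ((if j = g.1 i then (1 : ℝ) else 0) - (if j = v g.1 i then 1 else 0)) *
                ∏ k ∈ univ.erase i, ((if x k = g.1 k then (1 : ℝ) else 0)
                  - (if x k = v g.1 k then 1 else 0)) := by
              intro j
              simp only [u]
              rw [← Finset.mul_prod_erase univ _ (mem_univ i)]
              congr 1
              · simp
              · apply Finset.prod_congr rfl
                intro k hk
                rw [Function.update_of_ne (Finset.ne_of_mem_erase hk)]
            simp_rw [h1]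
            rw [← Finset.sum_mul, Finset.sum_sub_distrib]
            simp
          rw [this, mul_zero]
        rw [Fin.sum_univ_succ] at hsum
        rw [show Function.update x i 0 = x by rw [← hxi]; simp] at hsum
        rw [Finset.sum_eq_zero (s := univ (α := Fin (n i)))] at hsum
        · simpa using hsum
        · intro j _
          apply ih
          have : (univ.filter (fun k => Function.update x i j.succ k = 0))
              = (univ.filter (fun k => x k = 0)).erase i := by
            ext k
            by_cases hk : k = i
            · subst hk; simp
            · simp [hk]
          rw [this, Finset.card_erase_of_mem hi, hx]; rfl
    by_contra hcon
    push Not at hcon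
    have hne : (univ.filter (fun g : H => α g ≠ 0)).Nonempty := by
      obtain ⟨g, hg⟩ := hcon
      exact ⟨g, by simpa using hg⟩
    obtain ⟨g, hg, hmin⟩ := Finset.exists_min_image _ (fun g : H => Φ g.1) hne
    have h0 := hzero _ g.1 rfl
    rw [Finset.sum_eq_single g] at h0
    · have h1 : u g.1 g.1 = 1 := by
        simp only [u]
        apply Finset.prod_eq_one
        intro i _
        simp [(hv g.1 g.2 i).symm]
      rw [h1, mul_one] at h0
      exact (mem_filter.1 hg).2 h0
    · intro g' _ hgg'
      by_contra hc
      have hα' : α g' ≠ 0 := left_ne_zero_of_mul hc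
      have hu : u g'.1 g.1 ≠ 0 := right_ne_zero_of_mul hc
      have hlt := htri g'.1 g'.2 g.1 g.2 (fun h => hgg' (Subtype.ext h.symm)) (by
        intro i
        have := (Finset.prod_ne_zero_iff.1 hu) i (mem_univ i)
        by_contra hcc
        push Not at hcc
        simp [hcc.1, hcc.2] at this)
      have := hmin g' (by simpa using hα')
      linarith
    · simp
  have := hLI.fintype_card_le_finrank
  simpa using this

lemma abstract_bound {ι : Type*} [Fintype ι] [DecidableEq ι] (n : ι → ℕ)
    (H : Finset ((i : ι) → Fin (n i + 1)))
    (D : Submodule ℝ ((i : ι) → Fin (n i + 1) → ℝ))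
    (hD : ∀ w ∈ D, ∀ i, ∑ j, w i j = 0)
    (hH : ∀ g ∈ H, ∃ c : ι → ℝ, (∀ i, 0 < c i) ∧
      (∀ w ∈ D, ∑ i, c i * w i (g i) = 0) ∧
      (∀ t : ι → ℝ, ∑ i, c i * t i = 0 → ∃ w ∈ D, ∀ i, w i (g i) = t i) ∧
      (∃ w ∈ D, w ≠ 0 ∧ (∀ i, w i (g i) = 0) ∧
        ∀ w' ∈ D, (∀ i, w' i (g i) = 0) → ∃ r : ℝ, w' = r • w)) :
    H.card ≤ ∏ i, n i := by
  classical
  have hH' : ∀ g, ∃ c : ι → ℝ, ∃ w : ((i : ι) → Fin (n i + 1) → ℝ), g ∈ H → (∀ i, 0 < c i) ∧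
      (∀ w ∈ D, ∑ i, c i * w i (g i) = 0) ∧
      (∀ t : ι → ℝ, ∑ i, c i * t i = 0 → ∃ w ∈ D, ∀ i, w i (g i) = t i) ∧
      (w ∈ D ∧ w ≠ 0 ∧ (∀ i, w i (g i) = 0) ∧
        ∀ w' ∈ D, (∀ i, w' i (g i) = 0) → ∃ r : ℝ, w' = r • w) := by
    intro g
    by_cases hg : g ∈ H
    · obtain ⟨c, h1, h2, h3, w, h4⟩ := hH g hg
      exact ⟨c, w, fun _ => ⟨h1, h2, h3, h4⟩⟩
    · exact ⟨0, 0, fun h => absurd h hg⟩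
  choose c ω hc using hH'
  let I : ((i : ι) → Fin (n i + 1)) → Finset ι := fun g => univ.filter (fun i => ω g i = 0)
  let Φ : ((i : ι) → Fin (n i + 1)) → ℝ := fun g => (∑ i ∈ I g, c g i) / (∑ i ∈ (I g)ᶜ, c g i)
  have hpos : ∀ g ∈ H, 0 < ∑ i ∈ (I g)ᶜ, c g i := by
    intro g hg
    obtain ⟨h1, -, -, -, h4, -⟩ := hc g hg
    apply Finset.sum_pos (fun i _ => h1 i)
    obtain ⟨i, hi⟩ := Function.ne_iff.1 h4
    exact ⟨i, by simpa [I] using hi⟩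
  have hv : ∀ g, ∃ v : (i : ι) → Fin (n i + 1), g ∈ H → (∀ i, v i ≠ g i) ∧
      (∀ y ∈ H, y ≠ g → (∀ i, y i = g i ∨ y i = v i) → Φ g < Φ y) := by
    intro g
    by_cases hg : g ∈ H
    swap
    · exact ⟨g, fun h => absurd h hg⟩
    obtain ⟨h1, h2, h3, h4, h5, h6, h7⟩ := hc g hg
    obtain ⟨w, hwD, hw⟩ := h3 (fun i => if i ∈ I g then 1 else - Φ g) (by
      have e : ∀ i, c g i * (if i ∈ I g then 1 else - Φ g) =
          (if i ∈ I g then c g i else 0) - Φ g * (if i ∈ (I g)ᶜ then c g i else 0) := by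
        intro i
        by_cases hi : i ∈ I g <;> simp [hi, mul_comm]
      simp_rw [e]
      rw [Finset.sum_sub_distrib, ← Finset.mul_sum, Finset.sum_ite_mem, Finset.sum_ite_mem]
      simp only [univ_inter]
      have := (hpos g hg).ne'
      simp only [Φ]
      field_simp
      ring)
    have hvi : ∀ i, ∃ j, (i ∈ I g → w i j ≤ 0) ∧ (i ∉ I g → ω g i j < 0) := by
      intro i
      by_cases hi : i ∈ I g
      · by_contra hcon
        push Not at hcon
        have hall : ∀ j, 0 < w i j := fun j => by
          by_contra hh
          exact (hcon j (fun _ => not_lt.1 hh)).1 hi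
        have := hD w hwD i
        have h' : 0 < ∑ j, w i j := Finset.sum_pos (fun j _ => hall j) ⟨0, mem_univ _⟩
        linarith
      · have hne : ω g i ≠ 0 := by simpa [I] using hi
        have hs := hD _ h4 i
        by_contra hcon
        push Not at hcon
        have hall : ∀ j, 0 ≤ ω g i j := fun j => (hcon j (fun h => absurd h hi)).2
        apply hne
        funext j
        exact (Finset.sum_eq_zero_iff_of_nonneg (fun j _ => hall j)).1 hs j (mem_univ j)
    choose v hvI hvO using hvi
    refine ⟨v, fun _ => ⟨?_, ?_⟩⟩
    · intro i hi
      by_cases hI : i ∈ I g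
      · have a := hvI i hI
        have b := hw i
        rw [hi, b, if_pos hI] at a
        linarith
      · have a := hvO i hI
        rw [hi, h6 i] at a
        exact lt_irrefl _ a
    · intro y hy hne hmix
      obtain ⟨k1, k2, k3, k4, k5, k6, k7⟩ := hc y hy
      have hle : ∀ i, ω g i (y i) ≤ 0 := by
        intro i
        by_cases hI : i ∈ I g
        · have : ω g i = 0 := by simpa [I] using hI
          simp [this]
        · rcases hmix i with h | h
          · rw [h, h6]
          · rw [h]; exact (hvO i hI).le
      have hz : ∀ i, ω g i (y i) = 0 := by
        have := k2 _ h4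
        intro i
        have := (Finset.sum_eq_zero_iff_of_nonpos
          (fun i _ => mul_nonpos_of_nonneg_of_nonpos (k1 i).le (hle i))).1 this i (mem_univ i)
        exact (mul_eq_zero.1 this).resolve_left (k1 i).ne'
      obtain ⟨r, hr⟩ := k7 _ h4 hz
      have hr0 : r ≠ 0 := by
        rintro rfl
        exact h5 (by simpa using hr)
      have hIeq : I y = I g := by
        ext i
        simp only [I, mem_filter, mem_univ, true_and]
        rw [hr]
        simp [hr0]
      have hyO : ∀ i ∉ I g, y i = g i := by
        intro i hi
        rcases hmix i with h | h
        · exact h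
        · have := hvO i hi
          rw [← h, hz i] at this
          exact absurd this (lt_irrefl _)
      have hrel := k2 w hwD
      rw [← Finset.sum_add_sum_compl (I g)] at hrel
      have hO : ∑ i ∈ (I g)ᶜ, c y i * w i (y i) = - Φ g * ∑ i ∈ (I g)ᶜ, c y i := by
        rw [Finset.mul_sum]
        apply Finset.sum_congr rfl
        intro i hi
        have hi' : i ∉ I g := by simpa using hi
        rw [hyO i hi', hw i, if_neg hi']; ring
      have hlt : ∑ i ∈ I g, c y i * w i (y i) < ∑ i ∈ I g, c y i := by
        have hterm : ∀ i ∈ I g, y i ≠ g i → c y i * w i (y i) < c y i := by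
          intro i hi h
          have h' := (hmix i).resolve_left h
          have := hvI i hi
          rw [h']
          nlinarith [k1 i]
        apply Finset.sum_lt_sum
        · intro i hi
          by_cases h : y i = g i
          · rw [h, hw i, if_pos hi, mul_one]
          · exact (hterm i hi h).le
        · obtain ⟨i, hi⟩ := Function.ne_iff.1 hne
          have hiI : i ∈ I g := by
            by_contra hh
            exact hi (hyO i hh)
          exact ⟨i, hiI, hterm i hiI hi⟩
      have hp := hpos y hy
      rw [hIeq] at hp
      show Φ g < (∑ i ∈ I y, c y i) / (∑ i ∈ (I y)ᶜ, c y i)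
      rw [hIeq, lt_div_iff₀ hp]
      linarith
  choose v hv using hv
  exact count_bound n H Φ v (fun g hg => (hv g hg).1) (fun g hg => (hv g hg).2)


lemma finrank_map_add_inf {X Y : Type*} [AddCommGroup X] [Module ℝ X] [AddCommGroup Y] [Module ℝ Y]
    [FiniteDimensional ℝ X] (U : Submodule ℝ X) (f : X →ₗ[ℝ] Y) :
    Module.finrank ℝ (U.map f) + Module.finrank ℝ (U ⊓ LinearMap.ker f : Submodule ℝ X)
      = Module.finrank ℝ U := by
  have h := (f.domRestrict U).finrank_range_add_finrank_ker
  rw [LinearMap.range_domRestrict, LinearMap.ker_domRestrict] at h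
  rw [← h, ← Submodule.finrank_map_subtype_eq U, Submodule.map_comap_subtype]

def tmS {ι : Type*} (n : ι → ℕ) : ((i : ι) → Fin (n i + 1) → ℝ) →ₗ[ℝ] (ι → ℝ) where
  toFun w := fun i => ∑ j, w i j
  map_add' a b := by ext i; simp [Finset.sum_add_distrib]
  map_smul' a b := by ext i; simp [Finset.mul_sum]

def tmEv {ι : Type*} (n : ι → ℕ) (g : (i : ι) → Fin (n i + 1)) :
    ((i : ι) → Fin (n i + 1) → ℝ) →ₗ[ℝ] (ι → ℝ) where
  toFun w := fun i => w i (g i)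
  map_add' a b := by ext i; simp
  map_smul' a b := by ext i; simp

def tmT {ι E : Type*} [Fintype ι] [AddCommGroup E] [Module ℝ E] (n : ι → ℕ)
    (A : (i : ι) → Fin (n i + 1) → E) :
    ((i : ι) → Fin (n i + 1) → ℝ) →ₗ[ℝ] E where
  toFun w := ∑ i, ∑ j, w i j • A i j
  map_add' a b := by simp [Finset.sum_add_distrib, add_smul]
  map_smul' a b := by simp [Finset.smul_sum, mul_smul]

lemma exists_weights {m : ℕ} {E : Type*} [AddCommGroup E] [Module ℝ E] (a : Fin m → E) (k : Fin m)
    (x : E) (hx : x ∈ convexHull ℝ (a '' {j | j ≠ k})) :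
    ∃ w : Fin m → ℝ, ∑ j, w j = 1 ∧ w k = 0 ∧ ∑ j, w j • a j = x := by
  have : convexHull ℝ (a '' {j | j ≠ k}) ⊆
      {x | ∃ w : Fin m → ℝ, ∑ j, w j = 1 ∧ w k = 0 ∧ ∑ j, w j • a j = x} := by
    apply convexHull_min
    · rintro _ ⟨j, hj, rfl⟩
      refine ⟨Pi.single j 1, by simp, ?_, ?_⟩
      · have : k ≠ j := fun h => hj h.symm
        simp [this]
      · simp [Pi.single_apply]
    · rintro x ⟨w, h1, h2, h3⟩ y ⟨w', h1', h2', h3'⟩ p q hp hq hpq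
      refine ⟨fun j => p * w j + q * w' j, ?_, ?_, ?_⟩
      · rw [Finset.sum_add_distrib, ← Finset.mul_sum, ← Finset.mul_sum, h1, h1']; linarith
      · simp [h2, h2']
      · simp only [add_smul, mul_smul, Finset.sum_add_distrib, ← Finset.smul_sum, h3, h3']
  exact this hx

lemma vectorSpan_le {ι E : Type*} [Fintype ι] [AddCommGroup E] [Module ℝ E] (n : ι → ℕ)
    (A : (i : ι) → Fin (n i + 1) → E) (g : (i : ι) → Fin (n i + 1)) :
    vectorSpan ℝ (∑ i, convexHull ℝ (A i '' {j | j ≠ g i}) : Set E) ≤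
      (LinearMap.ker (tmS n) ⊓ LinearMap.ker (tmEv n g)).map (tmT n A) := by
  rw [vectorSpan, Submodule.span_le]
  rintro _ ⟨x, hx, y, hy, rfl⟩
  rw [Set.mem_fintype_sum] at hx hy
  obtain ⟨x', hx', rfl⟩ := hx
  obtain ⟨y', hy', rfl⟩ := hy
  choose a ha1 ha2 ha3 using fun i => exists_weights (A i) (g i) (x' i) (hx' i)
  choose b hb1 hb2 hb3 using fun i => exists_weights (A i) (g i) (y' i) (hy' i)
  refine ⟨fun i j => a i j - b i j, ⟨?_, ?_⟩, ?_⟩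
  · rw [SetLike.mem_coe, LinearMap.mem_ker]
    ext i
    simp [tmS, ha1, hb1]
  · rw [SetLike.mem_coe, LinearMap.mem_ker]
    ext i
    simp [tmEv, ha2, hb2]
  · simp [tmT, sub_smul, Finset.sum_sub_distrib, ha3, hb3]

lemma exists_functional {ι : Type*} [Fintype ι] [DecidableEq ι] {d : ℕ} (n : ι → ℕ)
    (hn : ∀ i, 1 ≤ n i)
    (A : (i : ι) → Fin (n i + 1) → EuclideanSpace ℝ (Fin d))
    (hA : ∀ i, AffineIndependent ℝ (A i)) (g : (i : ι) → Fin (n i + 1))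
    (hF : IsFaceOf (∑ i, convexHull ℝ (Set.range (A i)))
      (∑ i, convexHull ℝ (A i '' {j | j ≠ g i}))) :
    ∃ (l : EuclideanSpace ℝ (Fin d) →ₗ[ℝ] ℝ) (M c : ι → ℝ), (∀ i, 0 < c i) ∧
      (∀ i j, l (A i j) = M i - c i * (if j = g i then 1 else 0)) := by
  obtain ⟨l, hl⟩ := hF
  have hex : ∀ i, ∃ j, j ≠ g i := by
    intro i
    have : Nontrivial (Fin (n i + 1)) := Fin.nontrivial_iff_two_le.2 (by have := hn i; omega)
    exact exists_ne (g i)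
  -- sums of vertices
  have hsumF : ∀ a : (i : ι) → Fin (n i + 1), (∀ i, a i ≠ g i) →
      ∑ i, A i (a i) ∈ (∑ i, convexHull ℝ (A i '' {j | j ≠ g i}) :
        Set (EuclideanSpace ℝ (Fin d))) := by
    intro a ha
    rw [Set.mem_fintype_sum]
    exact ⟨_, fun i => subset_convexHull ℝ _ ⟨a i, ha i, rfl⟩, rfl⟩
  have hsumS : ∀ a : (i : ι) → Fin (n i + 1), 
      ∑ i, A i (a i) ∈ (∑ i, convexHull ℝ (Set.range (A i)) :
        Set (EuclideanSpace ℝ (Fin d))) := by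
    intro a
    rw [Set.mem_fintype_sum]
    exact ⟨_, fun i => subset_convexHull ℝ _ ⟨a i, rfl⟩, rfl⟩
  have hupd : ∀ (f : EuclideanSpace ℝ (Fin d) →ₗ[ℝ] ℝ) (a : (i : ι) → Fin (n i + 1)) i k,
      f (∑ i', A i' (Function.update a i k i')) = f (∑ i', A i' (a i')) - f (A i (a i))
        + f (A i k) := by
    intro f a i k
    rw [map_sum, map_sum, ← Finset.add_sum_erase _ _ (mem_univ i),
      ← Finset.add_sum_erase _ (fun i' => f (A i' (a i'))) (mem_univ i)]
    rw [Finset.sum_congr rfl (g := fun i' => f (A i' (a i')))]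
    · simp; ring
    · intro k hk
      rw [Function.update_of_ne (Finset.ne_of_mem_erase hk)]
  choose a₀ ha₀ using hex
  have hmax : ∀ i j k, j ≠ g i → l (A i k) ≤ l (A i j) := by
    intro i j k hj
    have h1 := hsumF (Function.update a₀ i j) (by
      intro i'
      by_cases h : i' = i
      · subst h; simpa using hj
      · simpa [h] using ha₀ i')
    rw [hl] at h1
    have h2 := h1.2 _ (hsumS (Function.update a₀ i k))
    rw [hupd, hupd] at h2
    linarith
  refine ⟨l, fun i => l (A i (a₀ i)), fun i => l (A i (a₀ i)) - l (A i (g i)), ?_, ?_⟩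
  · intro i
    have hle := hmax i (a₀ i) (g i) (ha₀ i)
    by_contra hcon
    have heq : l (A i (a₀ i)) = l (A i (g i)) := by
      simp only [sub_pos, not_lt] at hcon; linarith
    have hnot : A i (g i) ∉ convexHull ℝ (A i '' {j | j ≠ g i}) := by
      intro hmem
      have := convexHull_subset_affineSpan _ hmem
      have h' := (hA i).notMem_affineSpan_sdiff (g i) Set.univ
      have e : (Set.univ \ {g i} : Set (Fin (n i + 1))) = {j | j ≠ g i} := by
        ext j; simp
      rw [e] at h'
      exact h' this
    obtain ⟨φ, u, hφ1, hφ2⟩ := geometric_hahn_banach_closed_point (convex_convexHull ℝ _)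
      (Set.Finite.isClosed_convexHull (𝕜 := ℝ) (Set.toFinite (A i '' {j | j ≠ g i}))) hnot
    -- maximising vertices
    have hbest : ∀ k, ∃ b, b ≠ g k ∧ ∀ j, j ≠ g k → φ (A k j) ≤ φ (A k b) := by
      intro k
      obtain ⟨b, hb, hb'⟩ := Finset.exists_max_image (univ.filter (fun j => j ≠ g k))
        (fun j => φ (A k j)) ⟨a₀ k, by simpa using ha₀ k⟩
      exact ⟨b, by simpa using hb, fun j hj => hb' j (by simpa using hj)⟩
    choose b hb hb' using hbest
    have hbl : ∀ x ∈ (∑ i, convexHull ℝ (A i '' {j | j ≠ g i}) :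
        Set (EuclideanSpace ℝ (Fin d))), φ x ≤ φ (∑ k, A k (b k)) := by
      intro x hx
      rw [Set.mem_fintype_sum] at hx
      obtain ⟨x', hx', rfl⟩ := hx
      rw [map_sum, map_sum]
      apply Finset.sum_le_sum
      intro k _
      have : convexHull ℝ (A k '' {j | j ≠ g k}) ⊆ {x | φ x ≤ φ (A k (b k))} := by
        apply convexHull_min
        · rintro _ ⟨j, hj, rfl⟩
          exact hb' k j hj
        · exact convex_halfSpace_le (φ.toLinearMap.isLinear) _
      exact this (hx' k)
    have hmem : ∑ k, A k (Function.update b i (g i) k) ∈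
        (∑ i, convexHull ℝ (A i '' {j | j ≠ g i}) : Set (EuclideanSpace ℝ (Fin d))) := by
      have hbF := hsumF b hb
      rw [hl] at hbF ⊢
      refine ⟨hsumS _, fun y hy => ?_⟩
      have h1 := hbF.2 y hy
      rw [hupd]
      have := hmax i (a₀ i) (b i) (ha₀ i)
      linarith
    have h1 := hbl _ hmem
    have h2 := hupd φ.toLinearMap b i (g i)
    simp only [ContinuousLinearMap.coe_coe] at h2
    rw [h2] at h1
    have := hφ1 _ (subset_convexHull ℝ _ ⟨b i, hb i, rfl⟩)
    linarith
  · intro i j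
    by_cases h : j = g i
    · simp [h]
    · simp only [h, if_false, mul_zero, sub_zero]
      exact le_antisymm (hmax i _ _ (ha₀ i)) (hmax i _ _ h)

theorem totally_mixed_aux (s d : ℕ) (n : Fin (s + 1) → ℕ) (hn : ∀ i, 1 ≤ n i)
    (hd : ∑ i, n i = d + s + 1) (hd1 : 1 ≤ d)
    (A : (i : Fin (s + 1)) → Fin (n i + 1) → EuclideanSpace ℝ (Fin d))
    (hA : ∀ i, AffineIndependent ℝ (A i)) (H : Finset ((i : Fin (s + 1)) → Fin (n i + 1)))
    (hH : ∀ g ∈ H, IsFaceOf (∑ i, convexHull ℝ (Set.range (A i)))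
        (∑ i, convexHull ℝ (A i '' {j | j ≠ g i})) ∧
        Module.finrank ℝ (vectorSpan ℝ (∑ i, convexHull ℝ (A i '' {j | j ≠ g i}) :
          Set (EuclideanSpace ℝ (Fin d)))) = d - 1) :
    H.card ≤ ∏ i, n i := by
  classical
  have hX : Module.finrank ℝ ((i : Fin (s + 1)) → Fin (n i + 1) → ℝ) = d + 2 * (s + 1) := by
    rw [Module.finrank_pi_fintype]
    simp [Finset.sum_add_distrib, hd]
    ring
  let D := LinearMap.ker (tmS n) ⊓ LinearMap.ker (tmT n A)
  have hDdim : s + 1 ≤ Module.finrank ℝ D := by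
    have h := ((tmS n).prod (tmT n A)).finrank_range_add_finrank_ker
    have h2 := ((tmS n).prod (tmT n A)).range.finrank_le
    rw [hX, LinearMap.ker_prod] at h
    simp only [Module.finrank_prod, Module.finrank_fintype_fun_eq_card, Fintype.card_fin,
      finrank_euclideanSpace] at h2
    show s + 1 ≤ Module.finrank ℝ (LinearMap.ker (tmS n) ⊓ LinearMap.ker (tmT n A) : Submodule ℝ _)
    omega
  apply abstract_bound n H D
  · intro w hw i
    exact congrFun (LinearMap.mem_ker.1 hw.1) i
  intro g hg
  obtain ⟨hface, hdim⟩ := hH g hg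
  obtain ⟨l, M, c, hc, hlA⟩ := exists_functional n hn A hA g hface
  have hrel : ∀ w ∈ D, ∑ i, c i * w i (g i) = 0 := by
    intro w hw
    have h1 : ∀ i, ∑ j, w i j = 0 := fun i => congrFun (LinearMap.mem_ker.1 hw.1) i
    have h2 : ∑ i, ∑ j, w i j • A i j = 0 := LinearMap.mem_ker.1 hw.2
    have h3 := congrArg l h2
    simp only [map_sum, map_smul, hlA, smul_eq_mul, map_zero, mul_sub, Finset.sum_sub_distrib,
      ← Finset.sum_mul, h1, zero_mul, zero_sub, Finset.sum_neg_distrib, neg_eq_zero] at h3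
    rw [← h3]
    apply Finset.sum_congr rfl
    intro i _
    simp [mul_comm]
  -- dimension counts
  have hU : Module.finrank ℝ
      (LinearMap.ker (tmS n) ⊓ LinearMap.ker (tmEv n g) : Submodule ℝ _) = d := by
    have h := ((tmS n).prod (tmEv n g)).finrank_range_add_finrank_ker
    have hsurj : ((tmS n).prod (tmEv n g)).range = ⊤ := by
      rw [LinearMap.range_eq_top]
      rintro ⟨p, q⟩
      have hex : ∀ i, ∃ j, j ≠ g i := by
        intro i
        have : Nontrivial (Fin (n i + 1)) := Fin.nontrivial_iff_two_le.2 (by have := hn i; omega)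
        exact exists_ne (g i)
      choose b hb using hex
      refine ⟨fun i => Pi.single (g i) (q i) + Pi.single (b i) (p i - q i), ?_⟩
      ext i
      · simp [tmS, Finset.sum_add_distrib]
      · simp [tmEv, (hb i).symm]
    rw [hsurj, finrank_top, hX, LinearMap.ker_prod] at h
    simp only [Module.finrank_prod, Module.finrank_fintype_fun_eq_card, Fintype.card_fin] at h
    omega
  have hK1 : Module.finrank ℝ (D ⊓ LinearMap.ker (tmEv n g) : Submodule ℝ _) ≤ 1 := by
    have h := finrank_map_add_inf (LinearMap.ker (tmS n) ⊓ LinearMap.ker (tmEv n g)) (tmT n A)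
    have h2 := Submodule.finrank_mono (vectorSpan_le n A g)
    rw [hdim] at h2
    rw [hU] at h
    have e : D ⊓ LinearMap.ker (tmEv n g) =
      LinearMap.ker (tmS n) ⊓ LinearMap.ker (tmEv n g) ⊓ LinearMap.ker (tmT n A) := inf_right_comm _ _ _
    rw [e]
    omega
  let C : (Fin (s + 1) → ℝ) →ₗ[ℝ] ℝ :=
    { toFun := fun t => ∑ i, c i * t i
      map_add' := fun a b => by simp [mul_add, Finset.sum_add_distrib]
      map_smul' := fun r a => by simp [Finset.mul_sum, mul_left_comm] }
  have hCker : Module.finrank ℝ (LinearMap.ker C) ≤ s := by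
    have h := C.finrank_range_add_finrank_ker
    have hr : Module.finrank ℝ (LinearMap.range C) ≠ 0 := by
      intro h0
      rw [Submodule.finrank_eq_zero, LinearMap.range_eq_bot] at h0
      have := LinearMap.congr_fun h0 (Pi.single 0 1)
      simp [C, Pi.single_apply] at this
      exact (hc 0).ne' this
    simp only [Module.finrank_fintype_fun_eq_card, Fintype.card_fin] at h
    omega
  have hle : D.map (tmEv n g) ≤ LinearMap.ker C := by
    rintro _ ⟨w, hw, rfl⟩
    exact LinearMap.mem_ker.2 (hrel w hw)
  have hadd := finrank_map_add_inf D (tmEv n g)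
  have hmono := Submodule.finrank_mono hle
  have heq : D.map (tmEv n g) = LinearMap.ker C :=
    Submodule.eq_of_le_of_finrank_le hle (by omega)
  have hK : Module.finrank ℝ (D ⊓ LinearMap.ker (tmEv n g) : Submodule ℝ _) = 1 := by omega
  refine ⟨c, hc, hrel, ?_, ?_⟩
  · intro t ht
    have : t ∈ D.map (tmEv n g) := by rw [heq]; exact LinearMap.mem_ker.2 ht
    obtain ⟨w, hw, h⟩ := this
    exact ⟨w, hw, fun i => congrFun h i⟩
  · obtain ⟨⟨w, hw⟩, hw0, hspan⟩ := finrank_eq_one_iff'.1 hK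
    refine ⟨w, hw.1, fun h => hw0 (Subtype.ext h), fun i => congrFun (LinearMap.mem_ker.1 hw.2) i, ?_⟩
    intro w' hw' hz
    obtain ⟨r, hr⟩ := hspan ⟨w', hw', LinearMap.mem_ker.2 (funext hz)⟩
    exact ⟨r, (congrArg Subtype.val hr).symm⟩

/-- **Upper bound on totally mixed facets of Minkowski sums of simplices.** Let
`P i ⊆ ℝ^{n - s - 1}` be an `n i`-dimensional simplex for `0 ≤ i ≤ s`, where
`n = n 0 + ⋯ + n s`, and suppose their Minkowski sum is full-dimensional. Then the
number of totally mixed facets (facets that decompose as a sum of facets of the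
summands) of `P 0 + ⋯ + P s` is at most `1 + n 0 ⋯ n s`. -/
theorem totally_mixed_facets_bound (s : ℕ) (n : Fin (s + 1) → ℕ) (hn : ∀ i, 1 ≤ n i)
    (A : (i : Fin (s + 1)) → Fin (n i + 1) → EuclideanSpace ℝ (Fin ((∑ i, n i) - s - 1)))
    (hA : ∀ i, AffineIndependent ℝ (A i))
    (hfull : affineSpan ℝ
        (∑ i, convexHull ℝ (Set.range (A i)) :
          Set (EuclideanSpace ℝ (Fin ((∑ i, n i) - s - 1)))) = ⊤) :
    Nat.card {F : Set (EuclideanSpace ℝ (Fin ((∑ i, n i) - s - 1))) //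
        IsFaceOf (∑ i, convexHull ℝ (Set.range (A i))) F ∧
        Module.finrank ℝ (vectorSpan ℝ F) = (∑ i, n i) - s - 2 ∧
        ∃ g : (i : Fin (s + 1)) → Fin (n i + 1),
          F = ∑ i, convexHull ℝ (A i '' {j | j ≠ g i})}
      ≤ 1 + ∏ i, n i := by
  classical
  have hsum : s + 1 ≤ ∑ i, n i := by
    calc s + 1 = ∑ i : Fin (s + 1), 1 := by simp
      _ ≤ _ := Finset.sum_le_sum (fun i _ => hn i)
  have hd1 : 1 ≤ (∑ i, n i) - s - 1 := by
    by_contra hcon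
    have h0 : (∑ i, n i) - s - 1 = 0 := by omega
    have : Subsingleton (EuclideanSpace ℝ (Fin ((∑ i, n i) - s - 1))) := by
      rw [h0]; infer_instance
    have h1 := (hA 0).injective (Subsingleton.elim (A 0 0) (A 0 (Fin.last _)))
    have h2 := congrArg Fin.val h1
    have := hn 0
    simp at h2
    omega
  let H : Finset ((i : Fin (s + 1)) → Fin (n i + 1)) := univ.filter (fun g =>
    IsFaceOf (∑ i, convexHull ℝ (Set.range (A i)))
        (∑ i, convexHull ℝ (A i '' {j | j ≠ g i})) ∧
        Module.finrank ℝ (vectorSpan ℝ (∑ i, convexHull ℝ (A i '' {j | j ≠ g i}) :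
          Set (EuclideanSpace ℝ (Fin ((∑ i, n i) - s - 1))))) = (∑ i, n i) - s - 1 - 1)
  have hcard : H.card ≤ ∏ i, n i :=
    totally_mixed_aux s _ n hn (by omega) hd1 A hA H (fun g hg => (mem_filter.1 hg).2)
  refine le_trans ?_ (le_trans hcard (Nat.le_add_left _ _))
  rw [← Fintype.card_coe, ← Nat.card_eq_fintype_card]
  refine Nat.card_le_card_of_injective (fun F => (⟨F.2.2.2.choose, ?_⟩ : H)) ?_
  · have hs := F.2.2.2.choose_spec
    have h1 := F.2.1
    have h2 := F.2.2.1
    rw [hs] at h1 h2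
    exact mem_filter.2 ⟨mem_univ _, h1, by rw [h2]; omega⟩
  · intro F G hFG
    have h := congrArg Subtype.val hFG
    simp only at h
    apply Subtype.ext
    rw [F.2.2.2.choose_spec, G.2.2.2.choose_spec, h]
end
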